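/- arXiv:2104.04020 — 9 statements merged into one kernel-verified Lean document; each statement's English description precedes it below -/
import Mathlib

section
/- Let N be a positive integer, let x_1, …, x_N be nonnegative real numbers with x_1 > 0, and let c > 0. Then the number of indices j ∈ {1, …, N} such that x_j > c · Σ_{i=1}^{j−1} x_i (where the empty sum for j = 1 equals 0) is at most max{ 1 , (1/log(1+c)) · log( (max_{1≤j≤N} x_j) / x_1 ) − (log c)/log(1+c) + 2 }. -/
open Classical in
theorem aux_growth (N : ℕ) (hN : 0 < N) (x : Fin N → ℝ)
    (hx : ∀ j, 0 ≤ x j) (c : ℝ) (hc : 0 < c) (A : Finset (Fin N))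
    (hA : ∀ j ∈ A, c * ∑ i ∈ Finset.univ.filter (fun i => i < j), x i < x j) (m : ℕ) :
    m + 1 ≤ N → (1 + c) ^ (A.filter (fun i : Fin N => (i : ℕ) < m + 1)).card * x ⟨0, hN⟩
      ≤ (1 + c) * ∑ i ∈ Finset.univ.filter (fun i : Fin N => (i : ℕ) < m + 1), x i := by
  induction m with
  | zero =>
    intro _
    have h1 : Finset.univ.filter (fun i : Fin N => (i : ℕ) < 0 + 1) = {⟨0, hN⟩} := by
      ext i; simp [Fin.ext_iff]
    have h2 : (A.filter (fun i : Fin N => (i : ℕ) < 0 + 1)).card ≤ 1 := by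
      calc _ ≤ (Finset.univ.filter (fun i : Fin N => (i : ℕ) < 0 + 1)).card :=
            Finset.card_le_card (Finset.filter_subset_filter _ (Finset.subset_univ _))
        _ = 1 := by rw [h1]; simp
    rw [h1, Finset.sum_singleton]
    apply mul_le_mul_of_nonneg_right _ (hx _)
    calc _ ≤ (1 + c) ^ 1 := pow_le_pow_right₀ (by linarith) h2
      _ = _ := pow_one _
  | succ m ih =>
    intro hm
    have ih := ih (by omega)
    have h1 : Finset.univ.filter (fun i : Fin N => (i : ℕ) < m + 1 + 1)
        = insert ⟨m + 1, hm⟩ (Finset.univ.filter (fun i : Fin N => (i : ℕ) < m + 1)) := by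
      ext i; simp [Fin.ext_iff]; omega
    rw [h1, Finset.sum_insert (by simp)]
    by_cases hmem : (⟨m + 1, hm⟩ : Fin N) ∈ A
    · have h2 : A.filter (fun i : Fin N => (i : ℕ) < m + 1 + 1)
          = insert ⟨m + 1, hm⟩ (A.filter (fun i : Fin N => (i : ℕ) < m + 1)) := by
        ext i
        by_cases hi : i = ⟨m + 1, hm⟩
        · subst hi; simp [hmem]
        · have : (i : ℕ) ≠ m + 1 := fun h => hi (Fin.ext h)
          simp only [Finset.mem_filter, Finset.mem_insert, hi, false_or]
          refine and_congr_right fun _ => ?_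
          omega
      rw [h2, Finset.card_insert_of_notMem (by simp), pow_succ]
      have h3 := hA _ hmem
      have h4 : Finset.univ.filter (fun i : Fin N => i < ⟨m + 1, hm⟩)
        = Finset.univ.filter (fun i : Fin N => (i : ℕ) < m + 1) := by
        ext i; simp [Fin.lt_def]
      rw [h4] at h3
      nlinarith
    · have h2 : A.filter (fun i : Fin N => (i : ℕ) < m + 1 + 1)
          = A.filter (fun i : Fin N => (i : ℕ) < m + 1) := by
        ext i
        simp only [Finset.mem_filter]
        refine and_congr_right fun h => ?_
        have : (i : ℕ) ≠ m + 1 := fun h' => hmem (by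
          have : i = ⟨m + 1, hm⟩ := Fin.ext h'
          rwa [← this])
        omega
      rw [h2]
      have := hx ⟨m + 1, hm⟩
      nlinarith

/-- Let `N` be a positive integer, `x_1, …, x_N` nonnegative reals with
`x_1 > 0`, and `c > 0`.  Then the number of indices `j` with
`x_j > c * ∑_{i=1}^{j-1} x_i` is at most
`max { 1, (1/log(1+c)) * log((max_j x_j)/x_1) - log c / log(1+c) + 2 }`. -/
theorem count_large_increments_le (N : ℕ) (hN : 0 < N) (x : Fin N → ℝ)
    (hx : ∀ j, 0 ≤ x j) (hx0 : 0 < x ⟨0, hN⟩) (c : ℝ) (hc : 0 < c) :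
    (({j : Fin N | c * ∑ i ∈ Finset.univ.filter (fun i => i < j), x i < x j} : Set (Fin N)).ncard : ℝ)
      ≤ max 1
        ((1 / Real.log (1 + c)) *
            Real.log ((Finset.univ.sup' (Finset.univ_nonempty_iff.mpr ⟨⟨0, hN⟩⟩) x) / x ⟨0, hN⟩)
          - Real.log c / Real.log (1 + c) + 2) := by
  classical
  set A : Finset (Fin N) := Finset.univ.filter
    (fun j => c * ∑ i ∈ Finset.univ.filter (fun i => i < j), x i < x j) with hAdef
  have hAc : ({j : Fin N | c * ∑ i ∈ Finset.univ.filter (fun i => i < j), x i < x j} : Set (Fin N)).ncard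
      = A.card := by
    rw [← Set.ncard_coe_finset]; congr 1; ext j; simp [hAdef]
  rw [hAc]
  have hA : ∀ j ∈ A, c * ∑ i ∈ Finset.univ.filter (fun i => i < j), x i < x j := by
    intro j hj; simpa [hAdef] using hj
  rcases Nat.lt_or_ge A.card 2 with h | h
  · apply le_max_of_le_left
    exact_mod_cast Nat.lt_succ_iff.mp h
  apply le_max_of_le_right
  have hne : A.Nonempty := Finset.card_pos.mp (by omega)
  set M := Finset.univ.sup' (Finset.univ_nonempty_iff.mpr ⟨⟨0, hN⟩⟩) x
  obtain ⟨j, hj⟩ : ∃ j, j = A.max' hne := ⟨_, rfl⟩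
  have hjA : j ∈ A := hj ▸ A.max'_mem hne
  have hjmax : ∀ i ∈ A, i ≤ j := fun i hi => hj ▸ A.le_max' i hi
  have hAj : A = insert j (A.filter (fun i : Fin N => (i : ℕ) < j)) := by
    ext i
    simp only [Finset.mem_insert, Finset.mem_filter]
    constructor
    · intro hi
      rcases (hjmax i hi).eq_or_lt with h | h
      · exact Or.inl h
      · exact Or.inr ⟨hi, h⟩
    · rintro (rfl | h)
      · exact hjA
      · exact h.1
  have hcard : A.card = (A.filter (fun i : Fin N => (i : ℕ) < j)).card + 1 := by
    conv_lhs => rw [hAj]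
    rw [Finset.card_insert_of_notMem (by simp)]
  have hj0 : (j : ℕ) ≠ 0 := by
    intro h0
    rw [h0] at hcard
    simp at hcard
    omega
  obtain ⟨m, hm⟩ := Nat.exists_eq_succ_of_ne_zero hj0
  have hg := aux_growth N hN x hx c hc A hA m (by have := j.2; omega)
  rw [← Nat.succ_eq_add_one, ← hm] at hg
  obtain ⟨k, hk⟩ : ∃ k, (A.filter (fun i : Fin N => (i : ℕ) < j)).card = k + 1 :=
    ⟨_, (Nat.succ_pred_eq_of_pos (by omega)).symm⟩
  rw [hk] at hg hcard
  have h3 := hA j hjA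
  have h4 : Finset.univ.filter (fun i : Fin N => i < j)
        = Finset.univ.filter (fun i : Fin N => (i : ℕ) < j) := by
        ext i; simp
  rw [h4] at h3
  have hM : x j ≤ M := Finset.le_sup' x (Finset.mem_univ j)
  have hg' : (1 + c) ^ k * x ⟨0, hN⟩ ≤ ∑ i ∈ Finset.univ.filter (fun i : Fin N => (i : ℕ) < j), x i := by
    rw [pow_succ, mul_comm ((1 + c) ^ k), mul_assoc] at hg
    exact le_of_mul_le_mul_left hg (by linarith)
  have h5 : c * (1 + c) ^ k ≤ M / x ⟨0, hN⟩ := by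
    rw [le_div_iff₀ hx0]
    have := mul_le_mul_of_nonneg_left hg' hc.le
    linarith
  have hl : 0 < Real.log (1 + c) := Real.log_pos (by linarith)
  have hp : (0:ℝ) < (1 + c) ^ k := by positivity
  have h6 := Real.log_le_log (by positivity) h5
  rw [Real.log_mul hc.ne' hp.ne', Real.log_pow] at h6
  have h7 : (k : ℝ) ≤ (Real.log (M / x ⟨0, hN⟩) - Real.log c) / Real.log (1 + c) := by
    rw [le_div_iff₀ hl]; linarith
  rw [hcard]
  push_cast
  rw [sub_div] at h7
  rw [one_div_mul_eq_div]
  linarith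
end

section
/- Let D be a lower semicontinuous metric on ℂ such that the Euclidean metric is continuous with respect to D and such that every D-bounded subset of ℂ is bounded in the Euclidean metric. Then every D-Cauchy sequence converges in (ℂ, D): if (z_n) is a sequence in ℂ with sup_{m,n ≥ N} D(z_n, z_m) → 0 as N → ∞, then there exists z ∈ ℂ with D(z_n, z) → 0. -/
open scoped ENNReal
open Filter

/-- Let `D` be a lower semicontinuous metric on `ℂ` such that the
Euclidean metric is continuous with respect to `D` and every `D`-bounded set is
Euclidean-bounded.  Then every `D`-Cauchy sequence converges in `(ℂ, D)`. -/
theorem lscMetric_cauchy_converges (D : ℂ → ℂ → ℝ≥0∞)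
    (hsymm : ∀ x y, D x y = D y x)
    (htri : ∀ x y z, D x z ≤ D x y + D y z)
    (hzero : ∀ x y, (D x y = 0 ↔ x = y))
    (hlsc : LowerSemicontinuous (fun p : ℂ × ℂ => D p.1 p.2))
    (heucl : ∀ (z : ℂ) (w : ℕ → ℂ),
      Tendsto (fun n => D (w n) z) atTop (nhds 0) → Tendsto w atTop (nhds z))
    (hbdd : ∀ Y : Set ℂ, (⨆ x ∈ Y, ⨆ y ∈ Y, D x y) < ⊤ → Bornology.IsBounded Y)
    (z : ℕ → ℂ)
    (hcauchy : Tendsto (fun N => ⨆ m ≥ N, ⨆ n ≥ N, D (z m) (z n)) atTop (nhds 0)) :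
    ∃ w : ℂ, Tendsto (fun n => D (z n) w) atTop (nhds 0) := by
  have hle : ∀ N m n, N ≤ m → N ≤ n →
      D (z m) (z n) ≤ ⨆ m ≥ N, ⨆ n ≥ N, D (z m) (z n) := by
    intro N m n hm hn
    exact le_iSup₂_of_le m hm (le_iSup₂_of_le n hn le_rfl)
  obtain ⟨N, hN⟩ := (hcauchy.eventually (gt_mem_nhds (zero_lt_one))).exists
  have hb : Bornology.IsBounded (z '' Set.Ici N) := by
    apply hbdd
    refine lt_of_le_of_lt ?_ (hN.trans ENNReal.one_lt_top)
    refine iSup₂_le ?_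
    rintro _ ⟨m, hm, rfl⟩
    refine iSup₂_le ?_
    rintro _ ⟨n, hn, rfl⟩
    exact hle N m n hm hn
  obtain ⟨w, -, φ, hφ, hw⟩ := tendsto_subseq_of_bounded (x := fun k => z (N + k)) hb
    (fun k => ⟨N + k, Nat.le_add_right N k, rfl⟩)
  refine ⟨w, ?_⟩
  have key : ∀ M, D (z M) w ≤ ⨆ m ≥ M, ⨆ n ≥ M, D (z m) (z n) := by
    intro M
    by_contra! h
    have h1 := hlsc (z M, w) _ h
    have h2 : Tendsto (fun k => (z M, z (N + φ k))) atTop (nhds (z M, w)) :=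
      tendsto_const_nhds.prodMk_nhds hw
    obtain ⟨k, hk, hkM⟩ := ((h2.eventually h1).and (eventually_ge_atTop M)).exists
    have h3 : M ≤ N + φ k := by
      have := hφ.id_le k
      simp only [id] at this
      omega
    exact absurd (hle M M _ le_rfl h3) (not_le.mpr hk)
  exact tendsto_of_tendsto_of_tendsto_of_le_of_le tendsto_const_nhds hcauchy
    (fun _ => zero_le) key
end

section
/- Let D be a lower semicontinuous metric on ℂ such that (ℂ, D) is a length space, the Euclidean metric is continuous with respect to D, and every D-bounded subset of ℂ is bounded in the Euclidean metric. Then every pair of points z, w ∈ ℂ with D(z,w) < ∞ can be joined by a D-geodesic, i.e., there exists a continuous (with respect to the Euclidean topology) path P from z to w whose D-length equals D(z,w). -/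
open scoped ENNReal
open Filter

/-- The `D`-length of a curve `P` over the interval `[a,b]`: the supremum over all
(monotone) partitions `a = t_0 ≤ t_1 ≤ ⋯ ≤ t_k = b` of the sums of the `D`-distances
between consecutive partition points. -/
noncomputable def pathLength (D : ℂ → ℂ → ℝ≥0∞) (P : ℝ → ℂ) (a b : ℝ) : ℝ≥0∞ :=
  ⨆ (k : ℕ) (t : Fin (k + 1) → ℝ) (_ : Monotone t) (_ : t 0 = a) (_ : t (Fin.last k) = b),
    ∑ i : Fin k, D (P (t i.castSucc)) (P (t i.succ))

/-- `(ℂ, D)` is a length space: for all `z, w`, `D z w` is the infimum of `D`-lengths of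
continuous paths from `z` to `w` (parametrized by `[0,1]`). -/
def IsLengthSpace (D : ℂ → ℂ → ℝ≥0∞) : Prop :=
  ∀ z w : ℂ, D z w =
    ⨅ (P : ℝ → ℂ) (_ : ContinuousOn P (Set.Icc 0 1)) (_ : P 0 = z) (_ : P 1 = w),
      pathLength D P 0 1

theorem aux_lsc (D : ℂ → ℂ → ℝ≥0∞)
    (hlsc : LowerSemicontinuous (fun p : ℂ × ℂ => D p.1 p.2))
    {F : Filter ℕ} [F.NeBot] {u v : ℕ → ℂ} {a b : ℂ} {c : ℕ → ℝ≥0∞} {c0 : ℝ≥0∞}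
    (hu : Tendsto u F (nhds a)) (hv : Tendsto v F (nhds b)) (hc : Tendsto c F (nhds c0))
    (h : ∀ n, D (u n) (v n) ≤ c n) : D a b ≤ c0 := by
  refine le_of_forall_lt fun y hy => ?_
  obtain ⟨y', hyy', hy'⟩ := exists_between hy
  refine lt_of_lt_of_le hyy' ?_
  have h1 := (hu.prodMk_nhds hv).eventually (hlsc (a, b) y' hy')
  refine ge_of_tendsto hc ?_
  filter_upwards [h1] with n hn
  exact hn.le.trans (h n)

theorem aux_compact (D : ℂ → ℂ → ℝ≥0∞)
    (hsymm : ∀ x y, D x y = D y x)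
    (htri : ∀ x y z, D x z ≤ D x y + D y z)
    (hlsc : LowerSemicontinuous (fun p : ℂ × ℂ => D p.1 p.2))
    (hbdd : ∀ Y : Set ℂ, (⨆ x ∈ Y, ⨆ y ∈ Y, D x y) < ⊤ → Bornology.IsBounded Y)
    (z : ℂ) (r : ℝ≥0∞) (hr : r ≠ ⊤) : IsCompact {y | D z y ≤ r} := by
  apply Metric.isCompact_of_isClosed_isBounded
  · have : LowerSemicontinuous (fun y => D z y) :=
      hlsc.comp (g := fun y : ℂ => (z, y)) (by fun_prop)
    exact this.isClosed_preimage r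
  · apply hbdd
    refine lt_of_le_of_lt (b := r + r) ?_ (by simp [lt_top_iff_ne_top, hr])
    refine iSup₂_le fun x hx => iSup₂_le fun y hy => ?_
    refine (htri x z y).trans (add_le_add ?_ hy)
    rw [hsymm]; exact hx

theorem aux_approx (D : ℂ → ℂ → ℝ≥0∞)
    (hzero : ∀ x y, (D x y = 0 ↔ x = y))
    (hlsc : LowerSemicontinuous (fun p : ℂ × ℂ => D p.1 p.2))
    (hlength : IsLengthSpace D)
    (z w : ℂ) (h : ℝ≥0∞) (hh : h ≠ ⊤) (hzw : D z w ≤ h + h) (ε : ℝ≥0∞) (hε : ε ≠ 0)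
    (hε' : ε ≠ ⊤) :
    ∃ m, D z m ≤ h + ε ∧ D m w ≤ h + ε := by
  have h1 : D z w < h + h + ε :=
    lt_of_le_of_lt hzw (ENNReal.lt_add_right (by simp [hh]) hε)
  rw [hlength z w] at h1
  simp only [iInf_lt_iff] at h1
  obtain ⟨P, hP, hP0, hP1, hlen⟩ := h1
  have key : ∀ t ∈ Set.Icc (0:ℝ) 1, D z (P t) + D (P t) w ≤ h + h + ε := by
    intro t ht
    refine le_trans ?_ hlen.le
    unfold pathLength
    refine le_iSup_of_le 2 (le_iSup_of_le ![0, t, 1] ?_)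
    refine le_iSup_of_le ?_ (le_iSup_of_le (by simp) (le_iSup_of_le (by simp [Fin.last]) ?_))
    · rw [Fin.monotone_iff_le_succ]
      intro i
      fin_cases i <;> simp [ht.1, ht.2]
    · rw [Fin.sum_univ_two]
      simp [hP0, hP1]
  have hPc : Continuous (fun t : Set.Icc (0:ℝ) 1 => P t) := continuousOn_iff_continuous_domRestrict.1 hP
  have lf : LowerSemicontinuous (fun t : Set.Icc (0:ℝ) 1 => D z (P t)) :=
    hlsc.comp (g := fun t : Set.Icc (0:ℝ) 1 => (z, P t)) (continuous_const.prodMk hPc)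
  have lg : LowerSemicontinuous (fun t : Set.Icc (0:ℝ) 1 => D (P t) w) :=
    hlsc.comp (g := fun t : Set.Icc (0:ℝ) 1 => (P t, w)) (hPc.prodMk continuous_const)
  have hpc := isPreconnected_closed_iff.1 (isPreconnected_univ (α := Set.Icc (0:ℝ) 1))
    _ _ (lf.isClosed_preimage (h + ε)) (lg.isClosed_preimage (h + ε)) ?_ ?_ ?_
  · obtain ⟨t, -, h1, h2⟩ := hpc
    exact ⟨P t, h1, h2⟩
  · intro t _
    by_contra hcon
    simp only [Set.mem_union, Set.mem_preimage, Set.mem_Iic, not_or, not_le] at hcon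
    have h2 := (ENNReal.add_lt_add hcon.1 hcon.2).trans_le (key t t.2)
    have : h + h + ε ≤ h + ε + (h + ε) := by
      calc h + h + ε ≤ h + h + ε + ε := le_self_add
        _ = _ := by ring
    exact absurd h2 (not_lt.2 this)
  · refine ⟨⟨0, by simp⟩, trivial, ?_⟩
    simp [hP0, (hzero z z).2 rfl]
  · refine ⟨⟨1, by simp⟩, trivial, ?_⟩
    simp [hP1, (hzero w w).2 rfl]

theorem aux_hyper : ((hyperfilter ℕ : Ultrafilter ℕ) : Filter ℕ) ≤ atTop := by
  rw [← Nat.cofinite_eq_atTop]; exact hyperfilter_le_cofinite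

theorem aux_ultra {K : Set ℂ} (hK : IsCompact K) (u : ℕ → ℂ) (hu : ∀ n, u n ∈ K) :
    ∃ x, Tendsto u (hyperfilter ℕ : Ultrafilter ℕ) (nhds x) := by
  obtain ⟨x, -, hx⟩ := hK.ultrafilter_le_nhds ((hyperfilter ℕ).map u) (by
    rw [le_principal_iff]
    exact Filter.mem_map.2 (Filter.univ_mem' hu))
  exact ⟨x, hx⟩

theorem aux_mid (D : ℂ → ℂ → ℝ≥0∞)
    (hsymm : ∀ x y, D x y = D y x)
    (htri : ∀ x y z, D x z ≤ D x y + D y z)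
    (hzero : ∀ x y, (D x y = 0 ↔ x = y))
    (hlsc : LowerSemicontinuous (fun p : ℂ × ℂ => D p.1 p.2))
    (hlength : IsLengthSpace D)
    (hbdd : ∀ Y : Set ℂ, (⨆ x ∈ Y, ⨆ y ∈ Y, D x y) < ⊤ → Bornology.IsBounded Y)
    (z w : ℂ) (h : ℝ≥0∞) (hh : h ≠ ⊤) (hzw : D z w ≤ h + h) :
    ∃ m, D z m ≤ h ∧ D m w ≤ h := by
  have h1 : ∀ n : ℕ, ∃ m, D z m ≤ h + ((n:ℝ≥0∞) + 1)⁻¹ ∧ D m w ≤ h + ((n:ℝ≥0∞) + 1)⁻¹ :=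
    fun n => aux_approx D hzero hlsc hlength z w h hh hzw _
      (by simp) (by simp)
  choose u hu1 hu2 using h1
  obtain ⟨m, hm⟩ := aux_ultra (aux_compact D hsymm htri hlsc hbdd z (h + 1) (by simp [hh])) u
    (fun n => (hu1 n).trans (by gcongr; simp))
  have hc : Tendsto (fun n : ℕ => h + ((n:ℝ≥0∞) + 1)⁻¹) (hyperfilter ℕ : Ultrafilter ℕ) (nhds h) := by
    refine Tendsto.mono_left ?_ aux_hyper
    have : Tendsto (fun n : ℕ => ((n:ℝ≥0∞) + 1)⁻¹) atTop (nhds 0) := by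
      have := (tendsto_add_atTop_iff_nat 1).2 ENNReal.tendsto_inv_nat_nhds_zero
      simpa using this
    simpa using this.const_add h
  exact ⟨m, aux_lsc D hlsc tendsto_const_nhds hm hc hu1, aux_lsc D hlsc hm tendsto_const_nhds hc hu2⟩

theorem aux_disc (D : ℂ → ℂ → ℝ≥0∞)
    (htri : ∀ x y z, D x z ≤ D x y + D y z)
    (hzero : ∀ x y, (D x y = 0 ↔ x = y))
    (hmid : ∀ (z w : ℂ) (h : ℝ≥0∞), h ≠ ⊤ → D z w ≤ h + h → ∃ m, D z m ≤ h ∧ D m w ≤ h)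
    (n : ℕ) : ∀ (z w : ℂ) (L : ℝ), 0 ≤ L → D z w ≤ ENNReal.ofReal L →
    ∃ P : ℝ → ℂ, P 0 = z ∧ P 1 = w ∧
      (∀ t, 0 ≤ t → t ≤ 1 → D z (P t) ≤ ENNReal.ofReal (L * t)) ∧
      (∀ s t, 0 ≤ s → s ≤ t → t ≤ 1 →
        D (P s) (P t) ≤ ENNReal.ofReal (L * (t - s) + L / 2 ^ n)) := by
  induction n with
  | zero =>
    intro z w L hL hD
    refine ⟨fun t => if t < 1 then z else w, by simp, by simp, ?_, ?_⟩
    · intro t h0 h1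
      by_cases ht : t < 1
      · simp [ht, (hzero z z).2 rfl]
      · obtain rfl : t = 1 := by linarith
        simpa using hD
    · intro s t h0 hst h1
      have hle : ENNReal.ofReal L ≤ ENNReal.ofReal (L * (t - s) + L / 2 ^ 0) := by
        apply ENNReal.ofReal_le_ofReal
        have := mul_nonneg hL (sub_nonneg.2 hst)
        simpa using this
      by_cases ht : t < 1
      · have hs : s < 1 := by linarith
        simp [ht, hs, (hzero z z).2 rfl]
      · by_cases hs : s < 1
        · simp only [ht, hs, if_true, if_false]; exact hD.trans hle
        · simp [ht, hs, (hzero w w).2 rfl]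
  | succ n ih =>
    intro z w L hL hD
    have hL2 : 0 ≤ L / 2 := by linarith
    obtain ⟨m, hm1, hm2⟩ := hmid z w (ENNReal.ofReal (L / 2)) ENNReal.ofReal_ne_top (by
      rw [← ENNReal.ofReal_add hL2 hL2]; simpa using hD)
    obtain ⟨P, hP0, hP1, hPa, hPb⟩ := ih z m (L / 2) hL2 hm1
    obtain ⟨Q, hQ0, hQ1, hQa, hQb⟩ := ih m w (L / 2) hL2 hm2
    have hpow : L / 2 / 2 ^ n = L / 2 ^ (n + 1) := by
      rw [pow_succ]; field_simp
    have hpn : 0 ≤ L / 2 ^ (n + 1) := by positivity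
    rw [hpow] at hPb hQb
    refine ⟨fun t => if t ≤ 1 / 2 then P (2 * t) else Q (2 * t - 1), by simp [hP0], ?_, ?_, ?_⟩
    · norm_num [hQ1]
    · intro t h0 h1
      by_cases ht : t ≤ 1 / 2
      · simp only [ht, if_true]
        refine (hPa (2 * t) (by linarith) (by linarith)).trans (le_of_eq ?_)
        congr 1; ring
      · simp only [ht, if_false]
        push Not at ht
        refine (htri z m _).trans ((add_le_add hm1 (hQa (2 * t - 1) (by linarith) (by linarith))).trans
          (le_of_eq ?_))
        rw [← ENNReal.ofReal_add hL2 (mul_nonneg hL2 (by linarith))]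
        congr 1; ring
    · intro s t h0 hst h1
      by_cases ht : t ≤ 1 / 2
      · have hs : s ≤ 1 / 2 := by linarith
        simp only [ht, hs, if_true]
        refine (hPb (2 * s) (2 * t) (by linarith) (by linarith) (by linarith)).trans (le_of_eq ?_)
        congr 1; ring
      · by_cases hs : s ≤ 1 / 2
        · simp only [ht, hs, if_true, if_false]
          push Not at ht
          have h2 := hPb (2 * s) 1 (by linarith) (by linarith) (by linarith)
          rw [hP1] at h2
          refine (htri _ m _).trans ((add_le_add h2 (hQa (2 * t - 1) (by linarith) (by linarith))).trans
            (le_of_eq ?_))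
          rw [← ENNReal.ofReal_add (add_nonneg (mul_nonneg hL2 (by linarith)) hpn)
            (mul_nonneg hL2 (by linarith))]
          congr 1; ring
        · simp only [ht, hs, if_false]
          push Not at ht hs
          refine (hQb (2 * s - 1) (2 * t - 1) (by linarith) (by linarith) (by linarith)).trans
            (le_of_eq ?_)
          congr 1; ring

/-- Let `D` be a lower semicontinuous metric on `ℂ` such that `(ℂ, D)` is a
length space, the Euclidean metric is continuous with respect to `D`, and every `D`-bounded
set is Euclidean-bounded.  Then every pair of points `z, w` with `D(z,w) < ∞` can be joined
by a `D`-geodesic, i.e. a continuous (in the Euclidean topology) path from `z` to `w` whose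
`D`-length equals `D(z,w)`. -/
theorem exists_geodesic (D : ℂ → ℂ → ℝ≥0∞)
    (hsymm : ∀ x y, D x y = D y x)
    (htri : ∀ x y z, D x z ≤ D x y + D y z)
    (hzero : ∀ x y, (D x y = 0 ↔ x = y))
    (hlsc : LowerSemicontinuous (fun p : ℂ × ℂ => D p.1 p.2))
    (hlength : IsLengthSpace D)
    (heucl : ∀ (z : ℂ) (w : ℕ → ℂ),
      Tendsto (fun n => D (w n) z) atTop (nhds 0) → Tendsto w atTop (nhds z))
    (hbdd : ∀ Y : Set ℂ, (⨆ x ∈ Y, ⨆ y ∈ Y, D x y) < ⊤ → Bornology.IsBounded Y)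
    (z w : ℂ) (hzw : D z w < ⊤) :
    ∃ P : ℝ → ℂ, ContinuousOn P (Set.Icc 0 1) ∧ P 0 = z ∧ P 1 = w ∧
      pathLength D P 0 1 = D z w := by
  have hmid := fun (z w : ℂ) (h : ℝ≥0∞) (hh : h ≠ ⊤) (hD : D z w ≤ h + h) =>
    aux_mid D hsymm htri hzero hlsc hlength hbdd z w h hh hD
  obtain ⟨L, hL, hLD⟩ : ∃ L : ℝ, 0 ≤ L ∧ ENNReal.ofReal L = D z w :=
    ⟨(D z w).toReal, ENNReal.toReal_nonneg, ENNReal.ofReal_toReal hzw.ne⟩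
  choose p hp0 hp1 hpa hpb using fun n => aux_disc D htri hzero hmid n z w L hL hLD.ge
  have hlim : ∀ t : Set.Icc (0:ℝ) 1, ∃ x,
      Tendsto (fun n => p n t) (hyperfilter ℕ : Ultrafilter ℕ) (nhds x) := by
    intro t
    refine aux_ultra (aux_compact D hsymm htri hlsc hbdd z (ENNReal.ofReal L)
      ENNReal.ofReal_ne_top) _ fun n => (hpa n t t.2.1 t.2.2).trans ?_
    exact ENNReal.ofReal_le_ofReal (mul_le_of_le_one_right hL t.2.2)
  choose q hq using hlim
  have hqle : ∀ s t : Set.Icc (0:ℝ) 1, s ≤ t → D (q s) (q t) ≤ ENNReal.ofReal (L * (t - s)) := by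
    intro s t hst
    refine aux_lsc D hlsc (hq s) (hq t) ?_ (fun n => hpb n s t s.2.1 hst t.2.2)
    refine Tendsto.mono_left ?_ aux_hyper
    refine ENNReal.tendsto_ofReal ?_
    have : Tendsto (fun n : ℕ => L / 2 ^ n) atTop (nhds 0) :=
      tendsto_const_nhds.div_atTop (tendsto_pow_atTop_atTop_of_one_lt (by norm_num))
    simpa using this.const_add (L * ((t:ℝ) - s))
  have hqabs : ∀ s t : Set.Icc (0:ℝ) 1, D (q s) (q t) ≤ ENNReal.ofReal (L * |(s:ℝ) - t|) := by
    intro s t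
    rcases le_total s t with h | h
    · rw [abs_sub_comm, abs_of_nonneg (sub_nonneg.2 (show ((_ : Set.Icc (0:ℝ) 1) : ℝ) ≤ ((_ : Set.Icc (0:ℝ) 1) : ℝ) from h))]; exact hqle s t h
    · rw [abs_of_nonneg (sub_nonneg.2 (show ((_ : Set.Icc (0:ℝ) 1) : ℝ) ≤ ((_ : Set.Icc (0:ℝ) 1) : ℝ) from h)), hsymm]; exact hqle t s h
  have hqc : Continuous q := by
    rw [continuous_iff_seqContinuous]
    intro s t hst
    refine heucl _ _ ?_
    refine tendsto_of_tendsto_of_tendsto_of_le_of_le tendsto_const_nhds ?_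
      (fun _ => zero_le) (fun n => hqabs (s n) t)
    have h1 : Tendsto (fun n => ((s n : ℝ))) atTop (nhds (t:ℝ)) :=
      (continuous_subtype_val.tendsto t).comp hst
    have h2 := ENNReal.tendsto_ofReal (((h1.sub_const (t:ℝ)).abs).const_mul L)
    simpa using h2
  have hq0 : q ⟨0, by simp⟩ = z := by
    refine tendsto_nhds_unique (hq _) ?_
    simp only [hp0]; exact tendsto_const_nhds
  have hq1 : q ⟨1, by simp⟩ = w := by
    refine tendsto_nhds_unique (hq _) ?_
    simp only [hp1]; exact tendsto_const_nhds
  have e0 : Set.projIcc (0:ℝ) 1 zero_le_one 0 = ⟨0, by simp⟩ := Set.projIcc_left _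
  have e1 : Set.projIcc (0:ℝ) 1 zero_le_one 1 = ⟨1, by simp⟩ := Set.projIcc_right _
  refine ⟨fun t => q (Set.projIcc 0 1 zero_le_one t), ?_, ?_, ?_, le_antisymm ?_ ?_⟩
  · exact (hqc.comp continuous_projIcc).continuousOn
  · simp only [e0, hq0]
  · simp only [e1, hq1]
  · unfold pathLength
    refine iSup_le fun k => iSup_le fun t => iSup_le fun ht => iSup_le fun h0 => iSup_le fun h1 => ?_
    have hmem : ∀ i, t i ∈ Set.Icc (0:ℝ) 1 := fun i =>
      ⟨h0 ▸ ht (Fin.zero_le i), h1 ▸ ht (Fin.le_last i)⟩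
    calc ∑ i : Fin k, D (q (Set.projIcc 0 1 zero_le_one (t i.castSucc)))
            (q (Set.projIcc 0 1 zero_le_one (t i.succ)))
        ≤ ∑ i : Fin k, ENNReal.ofReal (L * (t i.succ - t i.castSucc)) := by
          refine Finset.sum_le_sum fun i _ => ?_
          rw [Set.projIcc_of_mem _ (hmem _), Set.projIcc_of_mem _ (hmem _)]
          exact hqle _ _ (ht (Fin.castSucc_lt_succ).le)
      _ = ENNReal.ofReal (∑ i : Fin k, L * (t i.succ - t i.castSucc)) := by
          rw [ENNReal.ofReal_sum_of_nonneg]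
          intro i _
          exact mul_nonneg hL (sub_nonneg.2 (ht (Fin.castSucc_lt_succ).le))
      _ = D z w := by
          rw [← hLD, ← Finset.mul_sum]
          congr 1
          have h2 : ∑ i : Fin k, (t i.succ - t i.castSucc) = t (Fin.last k) - t 0 := by
            have a := Fin.sum_univ_succ t
            have b := Fin.sum_univ_castSucc t
            rw [Finset.sum_sub_distrib]; linarith
          rw [h2, h0, h1]; ring
  · unfold pathLength
    refine le_iSup_of_le 1 (le_iSup_of_le ![0, 1] ?_)
    refine le_iSup_of_le ?_ (le_iSup_of_le (by simp) (le_iSup_of_le (by simp [Fin.last]) ?_))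
    · rw [Fin.monotone_iff_le_succ]
      intro i
      fin_cases i; simp
    · rw [Fin.sum_univ_one]
      have a : q 0 = z := hq0
      have b : q 1 = w := hq1
      simp [a, b]
end

section
/- Let D be a lower semicontinuous metric on ℂ such that (ℂ, D) is a length space. Let X ⊆ ℂ and r > 0, and assume that the set B_r[X; D] is closed in the Euclidean topology. Let V be a connected component (in the Euclidean topology) of ℂ ∖ B_r[X; D], and assume further that D(v, X) ≥ r for every point v in the Euclidean boundary ∂V of V. Then for every z ∈ V, D(z, ∂V) + r = D(z, X). -/
open scoped ENNReal

/-- Let `D` be a lower semicontinuous metric on `ℂ` such that `(ℂ, D)` is a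
length space.  Let `X ⊆ ℂ` and `r > 0`, and assume `B_r[X; D]` is closed in the Euclidean
topology.  Let `V` be a (Euclidean) connected component of `ℂ ∖ B_r[X; D]`, and assume that
`D(v, X) ≥ r` for every `v` in the Euclidean boundary of `V`.  Then for every `z ∈ V`,
`D(z, ∂V) + r = D(z, X)`. -/
theorem dist_component_add (D : ℂ → ℂ → ℝ≥0∞)
    (hsymm : ∀ x y, D x y = D y x)
    (htri : ∀ x y z, D x z ≤ D x y + D y z)
    (hzero : ∀ x y, (D x y = 0 ↔ x = y))
    (hlsc : LowerSemicontinuous (fun p : ℂ × ℂ => D p.1 p.2))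
    (hlength : IsLengthSpace D)
    (X : Set ℂ) (r : ℝ≥0∞) (hr : 0 < r)
    (hclosed : IsClosed {y : ℂ | (⨅ x ∈ X, D y x) ≤ r})
    (V : Set ℂ)
    (hV : ∃ y ∈ {y : ℂ | (⨅ x ∈ X, D y x) ≤ r}ᶜ,
      V = connectedComponentIn {y : ℂ | (⨅ x ∈ X, D y x) ≤ r}ᶜ y)
    (hbound : ∀ v ∈ frontier V, r ≤ ⨅ x ∈ X, D v x)
    (z : ℂ) (hz : z ∈ V) :
    (⨅ v ∈ frontier V, D z v) + r = ⨅ x ∈ X, D z x := by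
  obtain ⟨y, hy, hVy⟩ := hV
  set B : Set ℂ := {y : ℂ | (⨅ x ∈ X, D y x) ≤ r} with hB
  have hVo : IsOpen V := by
    rw [hVy]; exact hclosed.isOpen_compl.connectedComponentIn
  have hVB : V ⊆ Bᶜ := by
    rw [hVy]; exact connectedComponentIn_subset _ _
  have hVp : IsPreconnected V := by
    rw [hVy]; exact isPreconnected_connectedComponentIn
  have hyV : y ∈ V := by
    rw [hVy]; exact mem_connectedComponentIn hy
  have hfr : ∀ v ∈ frontier V, v ∈ B := by
    intro v hv
    by_contra hvB
    have hvV : v ∉ V := by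
      rw [hVo.frontier_eq] at hv
      exact hv.2
    apply hvV
    have hp : IsPreconnected (insert v V) :=
      hVp.subset_closure (Set.subset_insert _ _)
        (Set.insert_subset (frontier_subset_closure hv) subset_closure)
    have hs := hp.subset_connectedComponentIn (Set.mem_insert_of_mem v hyV)
      (Set.insert_subset hvB hVB)
    rw [← hVy] at hs
    exact hs (Set.mem_insert _ _)
  apply le_antisymm
  · refine le_iInf₂ fun x hx => ?_
    rw [hlength z x]
    refine le_iInf fun P => le_iInf fun hP => le_iInf fun h0 => le_iInf fun h1 => ?_
    have hxV : x ∉ V := fun h => hVB h (by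
      have : (⨅ x' ∈ X, D x x') ≤ D x x := iInf₂_le x hx
      rw [(hzero x x).2 rfl] at this
      exact this.trans hr.le)
    have hc : IsPreconnected (P '' Set.Icc 0 1) := isPreconnected_Icc.image P hP
    have hne : (P '' Set.Icc 0 1 ∩ frontier V).Nonempty := by
      by_contra hcon
      have hd : ∀ w ∈ P '' Set.Icc 0 1, w ∉ frontier V := fun w hw hf => hcon ⟨w, hw, hf⟩
      have hz' : z ∈ P '' Set.Icc 0 1 := ⟨0, by simp, h0⟩
      have hx' : x ∈ P '' Set.Icc 0 1 := ⟨1, by simp, h1⟩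
      have hsub : P '' Set.Icc 0 1 ⊆ V ∪ (closure V)ᶜ := by
        intro w hw
        by_cases h : w ∈ V
        · exact Or.inl h
        · refine Or.inr fun hcl => hd w hw ?_
          rw [hVo.frontier_eq]
          exact ⟨hcl, h⟩
      have hx2 : x ∈ (closure V)ᶜ := (hsub hx').resolve_left hxV
      obtain ⟨w, _, hw1, hw2⟩ := hc V (closure V)ᶜ hVo isClosed_closure.isOpen_compl hsub
        ⟨z, hz', hz⟩ ⟨x, hx', hx2⟩
      exact hw2 (subset_closure hw1)
    obtain ⟨_, ⟨t, ht, rfl⟩, hf⟩ := hne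
    have hlen : D z (P t) + D (P t) x ≤ pathLength D P 0 1 := by
      have hm : Monotone (![0, t, 1] : Fin 3 → ℝ) := by
        rw [Fin.monotone_iff_le_succ]
        intro i
        fin_cases i
        · simpa using ht.1
        · simpa using ht.2
      unfold pathLength
      refine le_iSup_of_le 2 (le_iSup_of_le ![0, t, 1] (le_iSup_of_le hm
        (le_iSup_of_le rfl (le_iSup_of_le rfl ?_))))
      simp [Fin.sum_univ_two, h0, h1]
    refine le_trans (add_le_add (iInf₂_le (P t) hf) ?_) hlen
    exact (hbound _ hf).trans (iInf₂_le x hx)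
  · rw [ENNReal.iInf_add]
    refine le_iInf fun v => ?_
    rw [ENNReal.iInf_add]
    refine le_iInf fun hv => ?_
    calc (⨅ x ∈ X, D z x) ≤ D z v + ⨅ x ∈ X, D v x := by
          rw [ENNReal.add_iInf]
          refine le_iInf fun x => ?_
          rw [ENNReal.add_iInf]
          exact le_iInf fun hx => (iInf₂_le x hx).trans (htri z v x)
      _ ≤ _ := add_le_add le_rfl (hfr v hv)
end

section
/- Let D_n (n ∈ ℕ) and D_∞ be lower semicontinuous metrics on ℂ such that D_n converges to D_∞ in the lower semicontinuous topology and the identity map from (ℂ, D_∞) to ℂ with the Euclidean metric is continuous. Let G ⊆ ℂ be compact and let F be a family of continuous real-valued functions on G that is relatively compact in the uniform topology (equivalently, uniformly bounded and uniformly equicontinuous). Then there exists a continuous nondecreasing function ω : [0,∞) → [0,∞) with ω(0) = 0 such that for every δ ≥ 0 the following hold: (i) for every sequence (f_n) in F and every sequence of compact sets A_n ⊆ G with liminf_{n→∞} diam(A_n; D_n) ≤ δ, one has liminf_{n→∞} osc_{A_n}(f_n) ≤ ω(δ); (ii) for every f ∈ F and every compact A ⊆ G with diam(A; D_∞) ≤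 δ, one has osc_A(f) ≤ ω(δ). -/
open scoped ENNReal
open Filter

theorem aux_sep (D : ℂ → ℂ → ℝ≥0∞) (h0 : ∀ x y, (D x y = 0 ↔ x = y))
    (hl : LowerSemicontinuous (fun p : ℂ × ℂ => D p.1 p.2))
    (G : Set ℂ) (hG : IsCompact G) (ε : ℝ) (hε : 0 < ε) :
    ∃ δ : ℝ, 0 < δ ∧ ∀ x ∈ G, ∀ y ∈ G, D x y ≤ ENNReal.ofReal δ → dist x y < ε := by
  have hK : IsCompact ((G ×ˢ G) ∩ {p : ℂ × ℂ | ε ≤ dist p.1 p.2}) :=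
    (hG.prod hG).inter_right (isClosed_le continuous_const (by fun_prop))
  rcases Set.eq_empty_or_nonempty ((G ×ˢ G) ∩ {p : ℂ × ℂ | ε ≤ dist p.1 p.2}) with he | hne
  · refine ⟨1, one_pos, fun x hx y hy _ => ?_⟩
    by_contra hcon
    have : (x, y) ∈ ((G ×ˢ G) ∩ {p : ℂ × ℂ | ε ≤ dist p.1 p.2}) :=
      ⟨⟨hx, hy⟩, not_lt.mp hcon⟩
    rw [he] at this
    exact this
  · obtain ⟨p, hp, hmin⟩ := (hl.lowerSemicontinuousOn _).exists_isMinOn hne hK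
    have hpos : D p.1 p.2 ≠ 0 := by
      intro h
      have h1 := (h0 _ _).1 h
      have h2 : ε ≤ dist p.1 p.2 := hp.2
      rw [h1, dist_self] at h2
      linarith
    obtain ⟨c, hc0, hc⟩ := ENNReal.lt_iff_exists_real_btwn.1 (pos_iff_ne_zero.2 hpos)
    refine ⟨c, ENNReal.ofReal_pos.1 hc.1, fun x hx y hy hxy => ?_⟩
    by_contra hcon
    have h3 : D p.1 p.2 ≤ D x y :=
      hmin (show (x, y) ∈ ((G ×ˢ G) ∩ {p : ℂ × ℂ | ε ≤ dist p.1 p.2}) from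
        ⟨⟨hx, hy⟩, not_lt.mp hcon⟩)
    exact absurd (lt_of_lt_of_le hc.2 (h3.trans hxy)) (lt_irrefl _)

theorem aux_extend (σ : ℕ → ℕ) (hσ : StrictMono σ) (u : ℕ → ℂ) (z : ℂ)
    (hu : Tendsto u atTop (nhds z)) :
    Tendsto (Function.extend σ u (fun _ => z)) atTop (nhds z) := by
  rw [tendsto_def] at hu ⊢
  intro U hU
  obtain ⟨K, hK⟩ := mem_atTop_sets.1 (hu U hU)
  refine mem_atTop_sets.2 ⟨σ K, fun n hn => ?_⟩
  by_cases h : ∃ k, σ k = n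
  · obtain ⟨k, rfl⟩ := h
    have : K ≤ k := hσ.le_iff_le.1 hn
    simpa [hσ.injective.extend_apply] using hK k this
  · simpa [Function.extend_apply' _ _ _ h] using mem_of_mem_nhds hU

theorem aux_sub (Dn : ℕ → ℂ → ℂ → ℝ≥0∞) (Dinf : ℂ → ℂ → ℝ≥0∞)
    (hconv_lower : ∀ (z w : ℂ) (zs ws : ℕ → ℂ),
      Tendsto zs atTop (nhds z) → Tendsto ws atTop (nhds w) →
      Dinf z w ≤ Filter.liminf (fun n => Dn n (zs n) (ws n)) atTop)
    (σ : ℕ → ℕ) (hσ : StrictMono σ) (u v : ℕ → ℂ) (z w : ℂ)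
    (hu : Tendsto u atTop (nhds z)) (hv : Tendsto v atTop (nhds w)) (c : ℝ≥0∞)
    (h : ∀ k, Dn (σ k) (u k) (v k) ≤ c) : Dinf z w ≤ c := by
  refine (hconv_lower z w _ _ (aux_extend σ hσ u z hu) (aux_extend σ hσ v w hv)).trans ?_
  apply Filter.liminf_le_of_frequently_le'
  rw [frequently_atTop]
  intro N
  refine ⟨σ N, hσ.id_le N, ?_⟩
  rw [hσ.injective.extend_apply, hσ.injective.extend_apply]
  exact h N

theorem aux_omega (S : Set (ℝ × ℝ)) (hne : S.Nonempty)
    (hpos : ∀ p ∈ S, 0 ≤ p.1 ∧ 0 ≤ p.2)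
    (hsmall : ∀ ε : ℝ, 0 < ε → ∃ b, (ε, b) ∈ S) :
    ∃ ω : ℝ → ℝ, ContinuousOn ω (Set.Ici 0) ∧ MonotoneOn ω (Set.Ici 0) ∧ ω 0 = 0 ∧
      (∀ x : ℝ, 0 ≤ x → 0 ≤ ω x) ∧
      ∀ δ : ℝ, 0 ≤ δ → ∀ L : ℝ, (∀ p ∈ S, L ≤ p.1 + p.2 * δ) → L ≤ ω δ := by
  set ω : ℝ → ℝ := fun t => sInf ((fun p : ℝ × ℝ => p.1 + p.2 * t) '' S) with hω
  have hle : ∀ t, 0 ≤ t → ∀ p ∈ S, ω t ≤ p.1 + p.2 * t := by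
    intro t ht p hp
    refine csInf_le ⟨0, ?_⟩ ⟨p, hp, rfl⟩
    rintro _ ⟨q, hq, rfl⟩
    have := hpos q hq
    have := mul_nonneg this.2 ht
    simp only
    linarith [(hpos q hq).1]
  have hge : ∀ t, ∀ L : ℝ, (∀ p ∈ S, L ≤ p.1 + p.2 * t) → L ≤ ω t := by
    intro t L h
    refine le_csInf (hne.image _) ?_
    rintro _ ⟨q, hq, rfl⟩
    exact h q hq
  have hnn : ∀ x : ℝ, 0 ≤ x → 0 ≤ ω x := by
    intro x hx
    refine hge x 0 fun p hp => ?_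
    have := mul_nonneg (hpos p hp).2 hx
    linarith [(hpos p hp).1]
  have h0 : ω 0 = 0 := by
    refine le_antisymm (le_of_forall_pos_le_add fun ε hε => ?_) (hnn 0 le_rfl)
    obtain ⟨b, hb⟩ := hsmall ε hε
    have := hle 0 le_rfl _ hb
    simpa using this
  have hmono : MonotoneOn ω (Set.Ici 0) := by
    intro s hs t ht hst
    refine hge t _ fun p hp => (hle s hs p hp).trans ?_
    have := mul_le_mul_of_nonneg_left hst (hpos p hp).2
    linarith
  have hconc : ConcaveOn ℝ (Set.Ici 0) ω := by
    refine ⟨convex_Ici 0, fun x hx y hy a b ha hb hab => ?_⟩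
    refine hge _ _ fun p hp => ?_
    have h1 := mul_le_mul_of_nonneg_left (hle x hx p hp) ha
    have h2 := mul_le_mul_of_nonneg_left (hle y hy p hp) hb
    simp only [smul_eq_mul]
    have h3 : p.1 = (a + b) * p.1 := by rw [hab, one_mul]
    nlinarith
  refine ⟨ω, ?_, hmono, h0, hnn, fun δ _ => hge δ⟩
  intro t ht
  rcases eq_or_lt_of_le (show (0:ℝ) ≤ t from ht) with h | h
  · subst h
    rw [ContinuousWithinAt, h0, Metric.tendsto_nhdsWithin_nhds]
    intro ε hε
    obtain ⟨b, hb⟩ := hsmall (ε / 2) (half_pos hε)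
    have hb0 : 0 ≤ b := (hpos _ hb).2
    refine ⟨ε / (2 * (b + 1)), by positivity, fun x hx hd => ?_⟩
    have hx0 : 0 ≤ x := hx
    rw [Real.dist_eq, sub_zero, abs_of_nonneg hx0] at hd
    rw [Real.dist_eq, sub_zero, abs_of_nonneg (hnn x hx0)]
    have h1 := hle x hx0 _ hb
    rw [lt_div_iff₀ (by positivity)] at hd
    simp only at h1
    nlinarith
  · have := hconc.continuousOn_interior
    rw [interior_Ici] at this
    exact (this.continuousAt (Ioi_mem_nhds h)).continuousWithinAt

/-- Let `D_n → D_∞` in the lower semicontinuous topology (all lower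
semicontinuous metrics on `ℂ`), with the identity map `(ℂ, D_∞) → (ℂ, |·|)` continuous.
Let `G ⊆ ℂ` be compact and `F` a family of continuous functions on `G` that is uniformly
bounded and uniformly equicontinuous (i.e. relatively compact in the uniform topology).
Then there is a continuous nondecreasing `ω : [0,∞) → [0,∞)` with `ω(0) = 0` such that for
all `δ ≥ 0`: (i) for sequences `f_n ∈ F` and compact `A_n ⊆ G` with
`liminf diam(A_n; D_n) ≤ δ`, one has `liminf osc_{A_n}(f_n) ≤ ω(δ)`; (ii) for `f ∈ F` and
compact `A ⊆ G` with `diam(A; D_∞) ≤ δ`, one has `osc_A(f) ≤ ω(δ)`. -/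
theorem oscillation_modulus (Dn : ℕ → ℂ → ℂ → ℝ≥0∞) (Dinf : ℂ → ℂ → ℝ≥0∞)
    (hDn : ∀ n : ℕ, (∀ x y, Dn n x y = Dn n y x) ∧
      (∀ x y z, Dn n x z ≤ Dn n x y + Dn n y z) ∧
      (∀ x y, (Dn n x y = 0 ↔ x = y)) ∧
      LowerSemicontinuous (fun p : ℂ × ℂ => Dn n p.1 p.2))
    (hDinf : (∀ x y, Dinf x y = Dinf y x) ∧
      (∀ x y z, Dinf x z ≤ Dinf x y + Dinf y z) ∧
      (∀ x y, (Dinf x y = 0 ↔ x = y)) ∧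
      LowerSemicontinuous (fun p : ℂ × ℂ => Dinf p.1 p.2))
    (hconv_lower : ∀ (z w : ℂ) (zs ws : ℕ → ℂ),
      Tendsto zs atTop (nhds z) → Tendsto ws atTop (nhds w) →
      Dinf z w ≤ Filter.liminf (fun n => Dn n (zs n) (ws n)) atTop)
    (hconv_attain : ∀ z w : ℂ, ∃ zs ws : ℕ → ℂ,
      Tendsto zs atTop (nhds z) ∧ Tendsto ws atTop (nhds w) ∧
      Tendsto (fun n => Dn n (zs n) (ws n)) atTop (nhds (Dinf z w)))
    (heucl : ∀ (z : ℂ) (ws : ℕ → ℂ),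
      Tendsto (fun n => Dinf (ws n) z) atTop (nhds 0) → Tendsto ws atTop (nhds z))
    (G : Set ℂ) (hG : IsCompact G)
    (F : Set (ℂ → ℝ)) (hFcont : ∀ f ∈ F, ContinuousOn f G)
    (hFbdd : ∃ M : ℝ, ∀ f ∈ F, ∀ x ∈ G, |f x| ≤ M)
    (hFequi : ∀ ε : ℝ, 0 < ε → ∃ δ : ℝ, 0 < δ ∧
      ∀ f ∈ F, ∀ x ∈ G, ∀ y ∈ G, dist x y < δ → |f x - f y| < ε) :
    ∃ ω : ℝ → ℝ, ContinuousOn ω (Set.Ici 0) ∧ MonotoneOn ω (Set.Ici 0) ∧ ω 0 = 0 ∧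
      (∀ x : ℝ, 0 ≤ x → 0 ≤ ω x) ∧
      ∀ δ : ℝ, 0 ≤ δ →
        ((∀ fs : ℕ → ℂ → ℝ, (∀ n, fs n ∈ F) →
            ∀ A : ℕ → Set ℂ, (∀ n, IsCompact (A n)) → (∀ n, A n ⊆ G) →
            Filter.liminf (fun n => ⨆ x ∈ A n, ⨆ y ∈ A n, Dn n x y) atTop
                ≤ ENNReal.ofReal δ →
            Filter.liminf
                (fun n => sSup {v : ℝ | ∃ x ∈ A n, ∃ y ∈ A n, v = |fs n x - fs n y|})
                atTop ≤ ω δ) ∧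
          (∀ f ∈ F, ∀ A : Set ℂ, IsCompact A → A ⊆ G →
            (⨆ x ∈ A, ⨆ y ∈ A, Dinf x y) ≤ ENNReal.ofReal δ →
            sSup {v : ℝ | ∃ x ∈ A, ∃ y ∈ A, v = |f x - f y|} ≤ ω δ)) := by
  obtain ⟨M, hM⟩ := hFbdd
  set S : Set (ℝ × ℝ) := {p | 0 ≤ p.1 ∧ 0 ≤ p.2 ∧ ∀ f ∈ F, ∀ x ∈ G, ∀ y ∈ G, ∀ s : ℝ, 0 ≤ s →
    Dinf x y ≤ ENNReal.ofReal s → |f x - f y| ≤ p.1 + p.2 * s} with hS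
  have hosc : ∀ f ∈ F, ∀ x ∈ G, ∀ y ∈ G, |f x - f y| ≤ 2 * |M| := by
    intro f hf x hx y hy
    have h1 := hM f hf x hx
    have h2 := hM f hf y hy
    have h3 := abs_sub (f x) (f y)
    have h4 := le_abs_self M
    linarith
  have hsmall : ∀ ε : ℝ, 0 < ε → ∃ b, (ε, b) ∈ S := by
    intro ε hε
    obtain ⟨r, hr, hfr⟩ := hFequi ε hε
    obtain ⟨d, hd, hdr⟩ := aux_sep Dinf hDinf.2.2.1 hDinf.2.2.2 G hG r hr
    refine ⟨2 * |M| / d, hε.le, by positivity, fun f hf x hx y hy s hs hD => ?_⟩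
    simp only
    have hb : 0 ≤ 2 * |M| / d := by positivity
    rcases le_total s d with h | h
    · have h1 := hfr f hf x hx y hy (hdr x hx y hy (hD.trans (ENNReal.ofReal_le_ofReal h)))
      have := mul_nonneg hb hs
      linarith
    · have h1 := hosc f hf x hx y hy
      have h2 := mul_le_mul_of_nonneg_left h hb
      rw [div_mul_cancel₀ _ hd.ne'] at h2
      linarith
  obtain ⟨ω, hc, hm, h0, hnn, hL⟩ := aux_omega S
    (by obtain ⟨b, hb⟩ := hsmall 1 one_pos; exact ⟨_, hb⟩) (fun p hp => ⟨hp.1, hp.2.1⟩) hsmall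
  refine ⟨ω, hc, hm, h0, hnn, fun δ hδ => ⟨?_, ?_⟩⟩
  · intro fs hfs A _ hAG hdiam
    refine hL δ hδ _ fun p hp => ?_
    obtain ⟨ha, hb, hp⟩ := hp
    by_contra hcon
    rw [not_le] at hcon
    obtain ⟨η, hη, hηlt⟩ : ∃ η : ℝ, 0 < η ∧ p.1 + p.2 * (δ + η) + 2 * η < Filter.liminf
                (fun n => sSup {v : ℝ | ∃ x ∈ A n, ∃ y ∈ A n, v = |fs n x - fs n y|})
                atTop := by
      set L := Filter.liminf
                (fun n => sSup {v : ℝ | ∃ x ∈ A n, ∃ y ∈ A n, v = |fs n x - fs n y|})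
                atTop
      refine ⟨(L - (p.1 + p.2 * δ)) / (p.2 + 3), div_pos (by linarith) (by linarith), ?_⟩
      have hη : 0 < (L - (p.1 + p.2 * δ)) / (p.2 + 3) := div_pos (by linarith) (by linarith)
      have h1 : (L - (p.1 + p.2 * δ)) / (p.2 + 3) * (p.2 + 3) = L - (p.1 + p.2 * δ) :=
        div_mul_cancel₀ _ (by linarith)
      nlinarith
    have hT : 0 ≤ p.1 + p.2 * (δ + η) + 2 * η := by positivity
    have hev := Filter.eventually_lt_of_lt_liminf hηlt
      ⟨0, Filter.eventually_map.2 (Eventually.of_forall fun n => Real.sSup_nonneg (by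
        rintro _ ⟨x, _, y, _, rfl⟩
        exact abs_nonneg _))⟩
    have hfr : ∃ᶠ n in atTop, (⨆ x ∈ A n, ⨆ y ∈ A n, Dn n x y) < ENNReal.ofReal (δ + η) :=
      Filter.frequently_lt_of_liminf_lt (by isBoundedDefault) (lt_of_le_of_lt hdiam
        ((ENNReal.ofReal_lt_ofReal_iff (by linarith)).2 (by linarith)))
    have hfr2 : ∃ᶠ n in atTop, ∃ q : ℂ × ℂ, q ∈ G ×ˢ G ∧
        Dn n q.1 q.2 ≤ ENNReal.ofReal (δ + η) ∧
        p.1 + p.2 * (δ + η) + 2 * η < |fs n q.1 - fs n q.2| := by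
      refine (hfr.and_eventually hev).mono ?_
      rintro n ⟨h1, h2⟩
      have hne : {v : ℝ | ∃ x ∈ A n, ∃ y ∈ A n, v = |fs n x - fs n y|}.Nonempty := by
        by_contra h
        rw [Set.not_nonempty_iff_eq_empty] at h
        rw [h, Real.sSup_empty] at h2
        linarith
      obtain ⟨_, ⟨x, hx, y, hy, rfl⟩, hlt⟩ := exists_lt_of_lt_csSup hne h2
      refine ⟨(x, y), ⟨hAG n hx, hAG n hy⟩, le_trans ?_ h1.le, hlt⟩
      exact le_iSup₂_of_le x hx (le_iSup₂_of_le y hy le_rfl)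
    obtain ⟨σ, hσ, hq⟩ := extraction_of_frequently_atTop hfr2
    choose q hqG hqD hqf using hq
    obtain ⟨z, hz, τ, hτ, hlim⟩ := (hG.prod hG).tendsto_subseq hqG
    have hl1 : Tendsto (fun k => (q (τ k)).1) atTop (nhds z.1) :=
      (continuous_fst.tendsto z).comp hlim
    have hl2 : Tendsto (fun k => (q (τ k)).2) atTop (nhds z.2) :=
      (continuous_snd.tendsto z).comp hlim
    have hDz := aux_sub Dn Dinf hconv_lower (σ ∘ τ) (hσ.comp hτ) _ _ z.1 z.2 hl1 hl2
      (ENNReal.ofReal (δ + η)) (fun k => hqD (τ k))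
    obtain ⟨r, hr, hfr⟩ := hFequi η hη
    obtain ⟨k, hk1, hk2⟩ := ((Metric.tendsto_nhds.1 hl1 r hr).and
      (Metric.tendsto_nhds.1 hl2 r hr)).exists
    have e1 := hfr _ (hfs (σ (τ k))) _ (hqG (τ k)).1 _ hz.1 hk1
    have e2 := hfr _ (hfs (σ (τ k))) _ (hqG (τ k)).2 _ hz.2 hk2
    have e3 := hp _ (hfs (σ (τ k))) _ hz.1 _ hz.2 (δ + η) (by linarith) hDz
    have e4 := hqf (τ k)
    rw [abs_lt] at e1 e2
    rw [abs_le] at e3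
    rcases lt_abs.1 e4 with h | h <;> linarith [e1.1, e1.2, e2.1, e2.2, e3.1, e3.2]
  · intro f hf A _ hAG hdiam
    refine hL δ hδ _ fun p hp => ?_
    apply Real.sSup_le
    · rintro _ ⟨x, hx, y, hy, rfl⟩
      refine hp.2.2 f hf x (hAG hx) y (hAG hy) δ hδ (le_trans ?_ hdiam)
      exact le_iSup₂_of_le x hx (le_iSup₂_of_le y hy le_rfl)
    · have := mul_nonneg hp.2.1 hδ
      linarith [hp.1]
end

section
/- Fix n ∈ ℤ and let S and S' be two dyadic squares of side length 2^{−n} (i.e., squares [a, a+2^{−n}] × [b, b+2^{−n}] with a, b ∈ 2^{−n}ℤ) that share an edge, i.e., S' = S + 2^{−n}e for some e ∈ {(1,0), (−1,0), (0,1), (0,−1)}. Let A_S and A_{S'} be the associated open square annuli. Then the image of every path around A_S intersects the image of every path around A_{S'}. -/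
/-- The sup-norm on `ℂ ≅ ℝ²`. -/
noncomputable def supNorm (z : ℂ) : ℝ := max |z.re| |z.im|

/-- The open square annulus between the concentric axis-parallel squares of side lengths
`2ℓ` and `3ℓ` centered at `v`, associated to a square of side length `ℓ` centered at `v`. -/
def sqAnnulus (v : ℂ) (ℓ : ℝ) : Set ℂ :=
  {x : ℂ | ℓ < supNorm (x - v) ∧ supNorm (x - v) < 3 / 2 * ℓ}

/-- The inner boundary `{x : ‖x − v‖_∞ = ℓ}` of the square annulus `sqAnnulus v ℓ`. -/
def innerBdry (v : ℂ) (ℓ : ℝ) : Set ℂ := {x : ℂ | supNorm (x - v) = ℓ}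

/-- The outer boundary `{x : ‖x − v‖_∞ = (3/2)ℓ}` of the square annulus `sqAnnulus v ℓ`. -/
def outerBdry (v : ℂ) (ℓ : ℝ) : Set ℂ := {x : ℂ | supNorm (x - v) = 3 / 2 * ℓ}

/-- A path around the square annulus `sqAnnulus v ℓ`: a continuous loop whose image lies in
the annulus and such that the inner and outer boundaries of the annulus lie in different
connected components of the complement of its image. -/
def IsPathAround (v : ℂ) (ℓ : ℝ) (γ : ℝ → ℂ) : Prop :=
  ContinuousOn γ (Set.Icc 0 1) ∧ γ 0 = γ 1 ∧
    γ '' Set.Icc 0 1 ⊆ sqAnnulus v ℓ ∧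
    ∀ p ∈ innerBdry v ℓ, ∀ q ∈ outerBdry v ℓ,
      q ∉ connectedComponentIn (γ '' Set.Icc 0 1)ᶜ p

theorem supNorm_smul_aux (v e : ℂ) (he : supNorm e = 1) (s : ℝ) :
    supNorm ((v + (s : ℂ) * e) - v) = |s| := by
  have h : (v + (s : ℂ) * e) - v = (s : ℂ) * e := by ring
  rw [h]
  unfold supNorm at *
  rw [Complex.re_ofReal_mul, Complex.im_ofReal_mul, abs_mul, abs_mul,
    ← mul_max_of_nonneg _ _ (abs_nonneg s), he, mul_one]

theorem ray_preconn_aux (v e : ℂ) (a b : ℝ) :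
    IsPreconnected ((fun s : ℝ => v + (s : ℂ) * e) '' Set.Icc a b) :=
  isPreconnected_Icc.image _ (by fun_prop)

theorem ray_hits_aux (v e : ℂ) (l : ℝ) (hl : 0 < l) (γ : ℝ → ℂ) (he : supNorm e = 1)
    (h : IsPathAround v l γ) :
    ∃ t : ℝ, l ≤ t ∧ t ≤ 3 / 2 * l ∧ v + (t : ℂ) * e ∈ γ '' Set.Icc 0 1 := by
  by_contra! hc
  have h1 := h.2.2.2 (v + (l : ℂ) * e)
    (by simp only [innerBdry, Set.mem_ofPred_eq, supNorm_smul_aux v e he]; exact abs_of_pos hl)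
    (v + ((3 / 2 * l : ℝ) : ℂ) * e)
    (by
      simp only [outerBdry, Set.mem_ofPred_eq, supNorm_smul_aux v e he]
      exact abs_of_pos (by linarith))
  apply h1
  refine (ray_preconn_aux v e l (3 / 2 * l)).subset_connectedComponentIn
    ⟨l, ⟨le_refl _, by linarith⟩, rfl⟩ ?_ ⟨3 / 2 * l, ⟨by linarith, le_refl _⟩, rfl⟩
  rintro _ ⟨t, ht, rfl⟩
  exact hc t ht.1 ht.2

theorem paths_meet_aux (v e : ℂ) (l : ℝ) (hl : 0 < l) (γ γ' : ℝ → ℂ) (he : supNorm e = 1)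
    (h : IsPathAround v l γ) (h' : IsPathAround (v + (l : ℂ) * e) l γ') :
    ((γ '' Set.Icc 0 1) ∩ (γ' '' Set.Icc 0 1)).Nonempty := by
  by_contra hne
  have hdis : ∀ x ∈ γ' '' Set.Icc 0 1, x ∉ γ '' Set.Icc 0 1 := fun x hx hx' => hne ⟨x, hx', hx⟩
  have he' : supNorm (-e) = 1 := by simpa [supNorm] using he
  obtain ⟨t, ht1, ht2, ht⟩ := ray_hits_aux _ _ l hl γ' he' h'
  obtain ⟨u, hu1, hu2, hu⟩ := ray_hits_aux _ _ l hl γ' he h'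
  have ht' : v + ((l - t : ℝ) : ℂ) * e ∈ γ' '' Set.Icc 0 1 := by
    convert ht using 1; push_cast; ring
  have hu' : v + ((l + u : ℝ) : ℂ) * e ∈ γ' '' Set.Icc 0 1 := by
    convert hu using 1; push_cast; ring
  have hK : IsPreconnected (γ' '' Set.Icc 0 1) := isPreconnected_Icc.image _ h'.1
  have hU := IsPreconnected.union (v + ((l - t : ℝ) : ℂ) * e)
    (s := (fun s : ℝ => v + (s : ℂ) * e) '' Set.Icc (l - t) l)
    ⟨l - t, ⟨le_refl _, by linarith⟩, rfl⟩ ht'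
    (ray_preconn_aux v e (l - t) l) hK
  have hU2 := IsPreconnected.union (v + ((l + u : ℝ) : ℂ) * e)
    (t := (fun s : ℝ => v + (s : ℂ) * e) '' Set.Icc (3 / 2 * l) (l + u)) (Or.inr hu')
    ⟨l + u, ⟨by linarith, le_refl _⟩, rfl⟩ hU (ray_preconn_aux v e (3 / 2 * l) (l + u))
  refine h.2.2.2 (v + (l : ℂ) * e)
    (by simp only [innerBdry, Set.mem_ofPred_eq, supNorm_smul_aux v e he]; exact abs_of_pos hl)
    (v + ((3 / 2 * l : ℝ) : ℂ) * e)
    (by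
      simp only [outerBdry, Set.mem_ofPred_eq, supNorm_smul_aux v e he]
      exact abs_of_pos (by linarith)) ?_
  refine hU2.subset_connectedComponentIn
    (Or.inl (Or.inl ⟨l, ⟨by linarith, le_refl _⟩, rfl⟩)) ?_
    (Or.inr ⟨3 / 2 * l, ⟨le_refl _, by linarith⟩, rfl⟩)
  rintro x ((⟨s, hs, rfl⟩ | hx) | ⟨s, hs, rfl⟩)
  · intro hx
    have := (h.2.2.1 hx).1
    rw [supNorm_smul_aux v e he] at this
    have := abs_le.2 ⟨by linarith [hs.1], hs.2⟩
    linarith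
  · exact hdis x hx
  · intro hx
    have := (h.2.2.1 hx).2
    rw [supNorm_smul_aux v e he] at this
    linarith [le_abs_self s, hs.1]

/-- Fix `n ∈ ℤ` and let `S, S'` be two dyadic squares of side length
`2⁻ⁿ` (with lower-left corners `(k 2⁻ⁿ, l 2⁻ⁿ)` and `(k' 2⁻ⁿ, l' 2⁻ⁿ)`, `k, l, k', l' ∈ ℤ`)
sharing an edge, i.e. `(k', l') = (k ± 1, l)` or `(k, l ± 1)`.  Then the image of every
path around `A_S` intersects the image of every path around `A_{S'}`. -/
theorem paths_around_adjacent_annuli_intersect (n : ℤ) (k l k' l' : ℤ)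
    (hadj : (k' = k + 1 ∧ l' = l) ∨ (k' = k - 1 ∧ l' = l) ∨
      (k' = k ∧ l' = l + 1) ∨ (k' = k ∧ l' = l - 1))
    (γ γ' : ℝ → ℂ)
    (hγ : IsPathAround ⟨((k : ℝ) + 1 / 2) * (2 : ℝ) ^ (-n), ((l : ℝ) + 1 / 2) * (2 : ℝ) ^ (-n)⟩
      ((2 : ℝ) ^ (-n)) γ)
    (hγ' : IsPathAround ⟨((k' : ℝ) + 1 / 2) * (2 : ℝ) ^ (-n), ((l' : ℝ) + 1 / 2) * (2 : ℝ) ^ (-n)⟩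
      ((2 : ℝ) ^ (-n)) γ') :
    ((γ '' Set.Icc 0 1) ∩ (γ' '' Set.Icc 0 1)).Nonempty := by
  have hl : (0 : ℝ) < (2 : ℝ) ^ (-n) := by positivity
  generalize (2 : ℝ) ^ (-n) = r at *
  obtain ⟨rfl, rfl⟩ | ⟨rfl, rfl⟩ | ⟨rfl, rfl⟩ | ⟨rfl, rfl⟩ := hadj
  · refine paths_meet_aux _ 1 r hl γ γ' (by simp [supNorm]) hγ ?_
    convert hγ' using 1
    apply Complex.ext <;> simp <;> ring
  · refine paths_meet_aux _ (-1) r hl γ γ' (by simp [supNorm]) hγ ?_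
    convert hγ' using 1
    apply Complex.ext <;> simp <;> ring
  · refine paths_meet_aux _ Complex.I r hl γ γ' (by simp [supNorm]) hγ ?_
    convert hγ' using 1
    apply Complex.ext <;> simp <;> ring
  · refine paths_meet_aux _ (-Complex.I) r hl γ γ' (by simp [supNorm]) hγ ?_
    convert hγ' using 1
    apply Complex.ext <;> simp <;> ring
end

section
/- Let S = [a, a+s] × [b, b+s] ⊆ ℂ be an axis-parallel closed square with side length s > 0 and let S' be one of the four dyadic children of S (the four closed squares of side length s/2 obtained by bisecting S both horizontally and vertically). Then every hash associated to S intersects every hash associated to S': for any hash H of S and any hash H' of S', H ∩ H' ≠ ∅. -/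
/-- The closed axis-parallel rectangle `[a₁, a₂] × [b₁, b₂]` in `ℂ ≅ ℝ²`. -/
def rect (a₁ a₂ b₁ b₂ : ℝ) : Set ℂ :=
  {z : ℂ | z.re ∈ Set.Icc a₁ a₂ ∧ z.im ∈ Set.Icc b₁ b₂}

/-- A continuous path contained in the rectangle `[a₁, a₂] × [b₁, b₂]` joining a point of
its bottom side (`im = b₁`) to a point of its top side (`im = b₂`). -/
def IsVPath (a₁ a₂ b₁ b₂ : ℝ) (P : ℝ → ℂ) : Prop :=
  ContinuousOn P (Set.Icc 0 1) ∧ (∀ t ∈ Set.Icc (0 : ℝ) 1, P t ∈ rect a₁ a₂ b₁ b₂) ∧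
    (P 0).im = b₁ ∧ (P 1).im = b₂

/-- A continuous path contained in the rectangle `[a₁, a₂] × [b₁, b₂]` joining a point of
its left side (`re = a₁`) to a point of its right side (`re = a₂`). -/
def IsHPath (a₁ a₂ b₁ b₂ : ℝ) (P : ℝ → ℂ) : Prop :=
  ContinuousOn P (Set.Icc 0 1) ∧ (∀ t ∈ Set.Icc (0 : ℝ) 1, P t ∈ rect a₁ a₂ b₁ b₂) ∧
    (P 0).re = a₁ ∧ (P 1).re = a₂

/-- A hash associated to the square `[a, a+s] × [b, b+s]`: the union of the images of four
continuous paths crossing the left half, the right half, the bottom half and the top half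
of the square between the two short sides of each rectangle. -/
def IsHash (a b s : ℝ) (H : Set ℂ) : Prop :=
  ∃ P₁ P₂ P₃ P₄ : ℝ → ℂ,
    IsVPath a (a + s / 2) b (b + s) P₁ ∧
    IsVPath (a + s / 2) (a + s) b (b + s) P₂ ∧
    IsHPath a (a + s) b (b + s / 2) P₃ ∧
    IsHPath a (a + s) (b + s / 2) (b + s) P₄ ∧
    H = P₁ '' Set.Icc 0 1 ∪ P₂ '' Set.Icc 0 1 ∪ P₃ '' Set.Icc 0 1 ∪ P₄ '' Set.Icc 0 1

lemma sin_trap (h : ℝ → ℝ) (hc : Continuous h)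
    (hs : ∀ t ∈ Set.Icc (0 : ℝ) 1, 0 ≤ Real.sin (h t)) (h0 : 0 ≤ h 0) (h0' : h 0 ≤ Real.pi) :
    0 ≤ h 1 ∧ h 1 ≤ Real.pi := by
  have hpi := Real.pi_pos
  constructor
  · by_contra hlt
    push Not at hlt
    have hm : max (h 1) (-(Real.pi / 2)) ∈ Set.Icc (h 1) (h 0) :=
      ⟨le_max_left _ _, max_le (by linarith) (by linarith)⟩
    obtain ⟨t, ht, hte⟩ := intermediate_value_Icc' (zero_le_one) hc.continuousOn hm
    have h1 : max (h 1) (-(Real.pi / 2)) < 0 := max_lt hlt (by linarith)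
    have h2 : -(Real.pi / 2) ≤ max (h 1) (-(Real.pi / 2)) := le_max_right _ _
    have := hs t ht
    rw [hte] at this
    have := Real.sin_neg_of_neg_of_neg_pi_lt h1 (by linarith)
    linarith
  · by_contra hlt
    push Not at hlt
    have hm : min (h 1) (Real.pi + Real.pi / 2) ∈ Set.Icc (h 0) (h 1) :=
      ⟨le_min (by linarith) (by linarith), min_le_left _ _⟩
    obtain ⟨t, ht, hte⟩ := intermediate_value_Icc (zero_le_one) hc.continuousOn hm
    have h1 : Real.pi < min (h 1) (Real.pi + Real.pi / 2) := lt_min hlt (by linarith)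
    have h2 : min (h 1) (Real.pi + Real.pi / 2) ≤ Real.pi + Real.pi / 2 := min_le_right _ _
    have h3 := hs t ht
    rw [hte] at h3
    have h4 := Real.sin_pos_of_pos_of_lt_pi
      (x := min (h 1) (Real.pi + Real.pi / 2) - Real.pi) (by linarith) (by linarith)
    rw [Real.sin_sub_pi] at h4
    linarith

/-- Two-dimensional Poincare-Miranda. -/
lemma miranda (F : C(ℝ × ℝ, ℂ))
    (e1 : ∀ u ∈ Set.Icc (0 : ℝ) 1, (F (0, u)).im ≤ 0)
    (e2 : ∀ t ∈ Set.Icc (0 : ℝ) 1, (F (t, 1)).re ≤ 0)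
    (e3 : ∀ u ∈ Set.Icc (0 : ℝ) 1, 0 ≤ (F (1, u)).im)
    (e4 : ∀ t ∈ Set.Icc (0 : ℝ) 1, 0 ≤ (F (t, 0)).re) :
    ∃ p, F p = 0 := by
  by_contra hne
  push Not at hne
  have hpi := Real.pi_pos
  obtain ⟨G, ⟨hG0, hG⟩, -⟩ := Complex.isCoveringMapOn_exp.existsUnique_continuousMap_lifts F
    (Complex.exp_log (hne (0, 0))) (fun p => hne p)
  have hGe : ∀ p, F p = Complex.exp (G p) := fun p => (congrFun hG p).symm
  have i0 : (0 : ℝ) ∈ Set.Icc (0 : ℝ) 1 := by simp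
  have i1 : (1 : ℝ) ∈ Set.Icc (0 : ℝ) 1 := by simp
  obtain ⟨θ, hθ⟩ : ∃ θ : ℝ × ℝ → ℝ, θ = fun p => (G p).im := ⟨_, rfl⟩
  have hθc : Continuous θ := by rw [hθ]; fun_prop
  have hre : ∀ p, (F p).re = Real.exp (G p).re * Real.cos (θ p) := fun p => by
    rw [hGe, Complex.exp_re, hθ]
  have him : ∀ p, (F p).im = Real.exp (G p).re * Real.sin (θ p) := fun p => by
    rw [hGe, Complex.exp_im, hθ]
  have c1 : ∀ u ∈ Set.Icc (0 : ℝ) 1, Real.sin (θ (0, u)) ≤ 0 := fun u hu => by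
    have := e1 u hu
    rw [him] at this
    exact nonpos_of_mul_nonpos_right this (Real.exp_pos _)
  have c2 : ∀ u ∈ Set.Icc (0 : ℝ) 1, Real.cos (θ (u, 1)) ≤ 0 := fun u hu => by
    have := e2 u hu
    rw [hre] at this
    exact nonpos_of_mul_nonpos_right this (Real.exp_pos _)
  have c3 : ∀ u ∈ Set.Icc (0 : ℝ) 1, 0 ≤ Real.sin (θ (1, u)) := fun u hu => by
    have := e3 u hu
    rw [him] at this
    exact nonneg_of_mul_nonneg_right this (Real.exp_pos _)
  have c4 : ∀ u ∈ Set.Icc (0 : ℝ) 1, 0 ≤ Real.cos (θ (u, 0)) := fun u hu => by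
    have := e4 u hu
    rw [hre] at this
    exact nonneg_of_mul_nonneg_right this (Real.exp_pos _)
  have t0 : θ (0, 0) = Complex.arg (F (0, 0)) := by
    rw [hθ]
    simp only [hG0, Complex.log_im]
  have l0 : -(Real.pi / 2) ≤ θ (0, 0) := by
    rw [t0]
    exact (abs_le.mp (Complex.abs_arg_le_pi_div_two_iff.mpr (e4 0 i0))).1
  have u0 : θ (0, 0) ≤ 0 := by
    by_contra hlt
    push Not at hlt
    have h5 : θ (0, 0) ≤ Real.pi / 2 := by
      rw [t0]
      exact (abs_le.mp (Complex.abs_arg_le_pi_div_two_iff.mpr (e4 0 i0))).2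
    have := Real.sin_pos_of_pos_of_lt_pi hlt (by linarith)
    linarith [c1 0 i0]
  -- edge 1
  obtain ⟨a1, b1⟩ := sin_trap (fun t => -θ (0, t)) (by fun_prop)
    (fun t ht => by rw [Real.sin_neg]; linarith [c1 t ht]) (by linarith) (by linarith)
  have d1 : θ (0, 1) ≤ -(Real.pi / 2) := by
    by_contra hlt
    push Not at hlt
    have := Real.cos_pos_of_mem_Ioo (x := θ (0, 1)) ⟨by linarith, by linarith⟩
    linarith [c2 0 i0]
  -- edge 2
  obtain ⟨a2, b2⟩ := sin_trap (fun t => -(θ (t, 1) + Real.pi / 2)) (by fun_prop)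
    (fun t ht => by rw [Real.sin_neg, Real.sin_add_pi_div_two]; linarith [c2 t ht])
    (by linarith) (by linarith)
  have d2 : θ (1, 1) ≤ -Real.pi := by
    by_contra hlt
    push Not at hlt
    have := Real.sin_neg_of_neg_of_neg_pi_lt (x := θ (1, 1)) (by linarith) (by linarith)
    linarith [c3 1 i1]
  -- edge 3
  obtain ⟨a3, b3⟩ := sin_trap (fun t => -(θ (1, 1 - t) + Real.pi)) (by fun_prop)
    (fun t ht => by
      rw [Real.sin_neg, Real.sin_add_pi]
      linarith [c3 (1 - t) ⟨by linarith [ht.2], by linarith [ht.1]⟩])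
    (by simp only [sub_zero]; linarith) (by simp only [sub_zero]; linarith)
  simp only [sub_self] at a3 b3
  have d3 : θ (1, 0) ≤ -(Real.pi + Real.pi / 2) := by
    by_contra hlt
    push Not at hlt
    have := Real.cos_pos_of_mem_Ioo (x := θ (1, 0) + Real.pi) ⟨by linarith, by linarith⟩
    rw [Real.cos_add_pi] at this
    linarith [c4 1 i1]
  -- edge 4
  obtain ⟨a4, b4⟩ := sin_trap (fun t => -(θ (1 - t, 0) + Real.pi / 2 + Real.pi)) (by fun_prop)
    (fun t ht => by
      rw [Real.sin_neg, Real.sin_add_pi, Real.sin_add_pi_div_two]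
      linarith [c4 (1 - t) ⟨by linarith [ht.2], by linarith [ht.1]⟩])
    (by simp only [sub_zero]; linarith) (by simp only [sub_zero]; linarith)
  simp only [sub_self] at a4 b4
  linarith

lemma cross (a₁ a₂ b₁ b₂ : ℝ) (V H : ℝ → ℂ) (hV : IsVPath a₁ a₂ b₁ b₂ V)
    (hH : IsHPath a₁ a₂ b₁ b₂ H) :
    (V '' Set.Icc 0 1 ∩ H '' Set.Icc 0 1).Nonempty := by
  obtain ⟨Vc, Vm, V0, V1⟩ := hV
  obtain ⟨Hc, Hm, H0, H1⟩ := hH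
  have i0 : (0 : ℝ) ∈ Set.Icc (0 : ℝ) 1 := by simp
  have i1 : (1 : ℝ) ∈ Set.Icc (0 : ℝ) 1 := by simp
  obtain ⟨π, hπ⟩ : ∃ π : ℝ → ℝ, π = fun t => (Set.projIcc (0 : ℝ) 1 zero_le_one t : ℝ) :=
    ⟨_, rfl⟩
  have πc : Continuous π := by
    rw [hπ]; exact continuous_subtype_val.comp continuous_projIcc
  have πm : ∀ t, π t ∈ Set.Icc (0 : ℝ) 1 := fun t => by rw [hπ]; exact Subtype.prop _
  have π0 : π 0 = 0 := by rw [hπ]; simp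
  have π1 : π 1 = 1 := by rw [hπ]; simp
  have c1 : Continuous fun t => V (π t) := Vc.comp_continuous πc πm
  have c2 : Continuous fun t => H (π t) := Hc.comp_continuous πc πm
  obtain ⟨p, hp⟩ := miranda
    ⟨fun p => V (π p.1) - H (π p.2), (c1.comp continuous_fst).sub (c2.comp continuous_snd)⟩
    (fun u _ => by
      simp only [ContinuousMap.coe_mk, Complex.sub_im, π0, V0]
      linarith [(Hm _ (πm u)).2.1])
    (fun u _ => by
      simp only [ContinuousMap.coe_mk, Complex.sub_re, π1, H1]
      linarith [(Vm _ (πm u)).1.2])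
    (fun u _ => by
      simp only [ContinuousMap.coe_mk, Complex.sub_im, π1, V1]
      linarith [(Hm _ (πm u)).2.2])
    (fun u _ => by
      simp only [ContinuousMap.coe_mk, Complex.sub_re, π0, H0]
      linarith [(Vm _ (πm u)).1.1])
  simp only [ContinuousMap.coe_mk] at hp
  exact ⟨V (π p.1), ⟨_, πm _, rfl⟩, ⟨_, πm _, (sub_eq_zero.mp hp).symm⟩⟩

/-- Let `S = [a, a+s] × [b, b+s]` be a square of side `s > 0` and `S'` one
of its four dyadic children (of side `s/2`, with lower-left corner `(a', b')`).  Then every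
hash associated to `S` intersects every hash associated to `S'`. -/
theorem hash_child_hash_intersect (a b s : ℝ) (hs : 0 < s) (a' b' : ℝ)
    (hchild : (a' = a ∧ b' = b) ∨ (a' = a + s / 2 ∧ b' = b) ∨
      (a' = a ∧ b' = b + s / 2) ∨ (a' = a + s / 2 ∧ b' = b + s / 2))
    (H H' : Set ℂ) (hH : IsHash a b s H) (hH' : IsHash a' b' (s / 2) H') :
    (H ∩ H').Nonempty := by
  obtain ⟨P₁, P₂, P₃, P₄, h1, h2, h3, h4, rfl⟩ := hH
  obtain ⟨Q₁, Q₂, Q₃, Q₄, k1, k2, k3, k4, rfl⟩ := hH'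
  have hb : b ≤ b' ∧ b' + s / 2 / 2 ≤ b + s := by
    rcases hchild with ⟨-, h⟩ | ⟨-, h⟩ | ⟨-, h⟩ | ⟨-, h⟩ <;> constructor <;> linarith
  have k : IsHPath a' (a' + s / 2) b (b + s) Q₃ := by
    obtain ⟨x, y, z, w⟩ := k3
    exact ⟨x, fun t ht => ⟨(y t ht).1, hb.1.trans (y t ht).2.1, (y t ht).2.2.trans hb.2⟩, z, w⟩
  have ha : a' = a ∨ a' = a + s / 2 := by tauto
  rcases ha with h | h
  · subst h
    obtain ⟨z, hz, hz'⟩ := cross _ _ _ _ _ _ h1 k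
    exact ⟨z, by simp only [Set.mem_union]; tauto, by simp only [Set.mem_union]; tauto⟩
  · subst h
    rw [show a + s / 2 + s / 2 = a + s by ring] at k
    obtain ⟨z, hz, hz'⟩ := cross _ _ _ _ _ _ h2 k
    exact ⟨z, by simp only [Set.mem_union]; tauto, by simp only [Set.mem_union]; tauto⟩
end

section
/- Let S = [a, a+s] × [b, b+s] ⊆ ℂ be an axis-parallel closed square with side length s > 0 and let S' be one of the four dyadic children of S (side length s/2, center v_{S'}). Let A_{S'} := {x ∈ ℂ : s/2 < ‖x − v_{S'}‖_∞ < (3/4)s} be the open square annulus associated to S'. Then every hash associated to S intersects the image of every path around A_{S'}. -/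
lemma key_crossing (v : ℂ) (l : ℝ) (hl : 0 ≤ l) (γ P : ℝ → ℂ) (hγ : IsPathAround v l γ)
    (hP : ContinuousOn P (Set.Icc 0 1)) (t₀ t₁ : ℝ) (h₀ : t₀ ∈ Set.Icc (0 : ℝ) 1)
    (h₁ : t₁ ∈ Set.Icc (0 : ℝ) 1) (hin : supNorm (P t₀ - v) ≤ l)
    (hout : supNorm (P t₁ - v) = 3 / 2 * l) :
    (P '' Set.Icc 0 1 ∩ γ '' Set.Icc 0 1).Nonempty := by
  by_contra hne
  rw [Set.not_nonempty_iff_eq_empty, ← Set.disjoint_iff_inter_eq_empty] at hne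
  obtain ⟨-, -, hsub, hsep⟩ := hγ
  have hK : IsPreconnected {x : ℂ | supNorm (x - v) ≤ l} := by
    have e : {x : ℂ | supNorm (x - v) ≤ l} =
        Complex.reLm ⁻¹' Set.Icc (v.re - l) (v.re + l) ∩
        Complex.imLm ⁻¹' Set.Icc (v.im - l) (v.im + l) := by
      ext x
      simp only [supNorm, Set.mem_setOf_eq, max_le_iff, abs_le, Set.mem_inter_iff,
        Set.mem_preimage, Set.mem_Icc, Complex.reLm_coe, Complex.imLm_coe, Complex.sub_re,
        Complex.sub_im]
      constructor
      · rintro ⟨⟨_, _⟩, _, _⟩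
        refine ⟨⟨?_, ?_⟩, ?_, ?_⟩ <;> linarith
      · rintro ⟨⟨_, _⟩, _, _⟩
        refine ⟨⟨?_, ?_⟩, ?_, ?_⟩ <;> linarith
    rw [e]
    exact (((convex_Icc _ _).linear_preimage _).inter
      ((convex_Icc _ _).linear_preimage _)).isPreconnected
  have hU := hK.union (P t₀) hin (Set.mem_image_of_mem P h₀) (isPreconnected_Icc.image P hP)
  have hp : supNorm (v + (l : ℂ) - v) = l := by
    simp [supNorm, abs_of_nonneg hl, hl]
  refine hsep (v + (l : ℂ)) hp (P t₁) hout
    (hU.subset_connectedComponentIn (Or.inl hp.le) ?_ (Or.inr (Set.mem_image_of_mem P h₁)))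
  rintro x (hx | hx) hxγ
  · exact absurd (hsub hxγ).1 (not_lt.mpr hx)
  · exact Set.disjoint_left.mp hne hx hxγ

/-- Let `S = [a, a+s] × [b, b+s]` be a square of side `s > 0` and `S'` one
of its four dyadic children (side `s/2`, lower-left corner `(a', b')`, hence center
`(a' + s/4, b' + s/4)`).  Then every hash associated to `S` intersects the image of every
path around the square annulus `A_{S'}`. -/
theorem hash_intersects_path_around_child (a b s : ℝ) (hs : 0 < s) (a' b' : ℝ)
    (hchild : (a' = a ∧ b' = b) ∨ (a' = a + s / 2 ∧ b' = b) ∨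
      (a' = a ∧ b' = b + s / 2) ∨ (a' = a + s / 2 ∧ b' = b + s / 2))
    (H : Set ℂ) (hH : IsHash a b s H)
    (γ : ℝ → ℂ) (hγ : IsPathAround ⟨a' + s / 4, b' + s / 4⟩ (s / 2) γ) :
    (H ∩ γ '' Set.Icc 0 1).Nonempty := by
  obtain ⟨P₁, P₂, P₃, P₄, ⟨c1, r1, s1, e1⟩, ⟨c2, r2, s2, e2⟩, -, -, rfl⟩ := hH
  have m0 : (0 : ℝ) ∈ Set.Icc (0 : ℝ) 1 := by simp
  have m1 : (1 : ℝ) ∈ Set.Icc (0 : ℝ) 1 := by simp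
  have hl : 0 ≤ s / 2 := by linarith
  have aux_in : ∀ (v z : ℂ), |z.re - v.re| ≤ s / 4 → |z.im - v.im| ≤ s / 4 →
      supNorm (z - v) ≤ s / 2 := by
    intro v z h h'
    simp only [supNorm, Complex.sub_re, Complex.sub_im]
    exact max_le (by linarith) (by linarith)
  have aux_out : ∀ (v z : ℂ), |z.re - v.re| ≤ s / 4 → |z.im - v.im| = 3 / 4 * s →
      supNorm (z - v) = 3 / 2 * (s / 2) := by
    intro v z h h'
    simp only [supNorm, Complex.sub_re, Complex.sub_im]
    rw [max_eq_right (by linarith), h']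
    ring
  have k1 : ∀ t₀ ∈ Set.Icc (0 : ℝ) 1, ∀ t₁ ∈ Set.Icc (0 : ℝ) 1, a' = a →
      |(P₁ t₀).im - (b' + s / 4)| ≤ s / 4 → |(P₁ t₁).im - (b' + s / 4)| = 3 / 4 * s →
      (P₁ '' Set.Icc 0 1 ∩ γ '' Set.Icc 0 1).Nonempty := by
    intro t₀ h₀ t₁ h₁ ha hi ho
    have R : ∀ t ∈ Set.Icc (0 : ℝ) 1, |(P₁ t).re - (a' + s / 4)| ≤ s / 4 := by
      intro t ht
      obtain ⟨⟨_, _⟩, _⟩ := r1 t ht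
      rw [abs_le]
      constructor <;> linarith
    exact key_crossing _ _ hl γ P₁ hγ c1 t₀ t₁ h₀ h₁ (aux_in _ _ (R t₀ h₀) hi)
      (aux_out _ _ (R t₁ h₁) ho)
  have k2 : ∀ t₀ ∈ Set.Icc (0 : ℝ) 1, ∀ t₁ ∈ Set.Icc (0 : ℝ) 1, a' = a + s / 2 →
      |(P₂ t₀).im - (b' + s / 4)| ≤ s / 4 → |(P₂ t₁).im - (b' + s / 4)| = 3 / 4 * s →
      (P₂ '' Set.Icc 0 1 ∩ γ '' Set.Icc 0 1).Nonempty := by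
    intro t₀ h₀ t₁ h₁ ha hi ho
    have R : ∀ t ∈ Set.Icc (0 : ℝ) 1, |(P₂ t).re - (a' + s / 4)| ≤ s / 4 := by
      intro t ht
      obtain ⟨⟨_, _⟩, _⟩ := r2 t ht
      rw [abs_le]
      constructor <;> linarith
    exact key_crossing _ _ hl γ P₂ hγ c2 t₀ t₁ h₀ h₁ (aux_in _ _ (R t₀ h₀) hi)
      (aux_out _ _ (R t₁ h₁) ho)
  have i1 : ∀ y : ℝ, y = -(s / 4) ∨ y = s / 4 → |y| ≤ s / 4 := by
    rintro y (rfl | rfl) <;> rw [abs_le] <;> constructor <;> linarith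
  have o1 : ∀ y : ℝ, y = -(3 / 4 * s) ∨ y = 3 / 4 * s → |y| = 3 / 4 * s := by
    intro y hy
    rw [abs_eq (by linarith)]
    exact hy.symm
  have f1 : (P₁ '' Set.Icc 0 1 ∩ γ '' Set.Icc 0 1).Nonempty →
      ((P₁ '' Set.Icc 0 1 ∪ P₂ '' Set.Icc 0 1 ∪ P₃ '' Set.Icc 0 1 ∪ P₄ '' Set.Icc 0 1) ∩
        γ '' Set.Icc 0 1).Nonempty :=
    fun ⟨x, hx, hx'⟩ => ⟨x, Or.inl (Or.inl (Or.inl hx)), hx'⟩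
  have f2 : (P₂ '' Set.Icc 0 1 ∩ γ '' Set.Icc 0 1).Nonempty →
      ((P₁ '' Set.Icc 0 1 ∪ P₂ '' Set.Icc 0 1 ∪ P₃ '' Set.Icc 0 1 ∪ P₄ '' Set.Icc 0 1) ∩
        γ '' Set.Icc 0 1).Nonempty :=
    fun ⟨x, hx, hx'⟩ => ⟨x, Or.inl (Or.inl (Or.inr hx)), hx'⟩
  rcases hchild with ⟨ha, hb⟩ | ⟨ha, hb⟩ | ⟨ha, hb⟩ | ⟨ha, hb⟩
  · exact f1 (k1 0 m0 1 m1 ha (i1 _ (Or.inl (by linarith))) (o1 _ (Or.inr (by linarith))))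
  · exact f2 (k2 0 m0 1 m1 ha (i1 _ (Or.inl (by linarith))) (o1 _ (Or.inr (by linarith))))
  · exact f1 (k1 1 m1 0 m0 ha (i1 _ (Or.inr (by linarith))) (o1 _ (Or.inl (by linarith))))
  · exact f2 (k2 1 m1 0 m0 ha (i1 _ (Or.inr (by linarith))) (o1 _ (Or.inl (by linarith))))
end

section
/- Let X ⊆ ℂ be a bounded set, and let x, T > 0 be such that Σ_{S ∈ 𝒮^m} #𝒮^n(X ∩ S) ≤ T · 2^{nx} for all integers 0 ≤ m ≤ n (where # denotes cardinality; all these counts are finite since X is bounded). Then for every ζ > 0, every A > 0, and every m ∈ ℕ, the number of squares S ∈ 𝒮^m(X) for which there exists an integer n ≥ m with #𝒮^n(X ∩ S) > A · T · 2^{(n−m)(x+ζ)} is at most (1 − 2^{−ζ})^{−1} · A^{−1} · 2^{m(x+ζ)}. -/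
/-- The closed dyadic square in `ℂ ≅ ℝ²` of side length `2⁻ⁿ` with lower-left corner
`(k · 2⁻ⁿ, l · 2⁻ⁿ)`. -/
def dyadicSq (n : ℕ) (k l : ℤ) : Set ℂ :=
  {z : ℂ | z.re ∈ Set.Icc ((k : ℝ) * (2 : ℝ) ^ (-(n : ℤ))) (((k : ℝ) + 1) * (2 : ℝ) ^ (-(n : ℤ))) ∧
    z.im ∈ Set.Icc ((l : ℝ) * (2 : ℝ) ^ (-(n : ℤ))) (((l : ℝ) + 1) * (2 : ℝ) ^ (-(n : ℤ)))}

lemma dy_int_bound (m : ℕ) (R t : ℝ) (k : ℤ) (ht : |t| ≤ R)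
    (h : t ∈ Set.Icc ((k : ℝ) * (2 : ℝ) ^ (-(m : ℤ))) (((k : ℝ) + 1) * (2 : ℝ) ^ (-(m : ℤ)))) :
    k ∈ Set.Icc (-⌈R * 2 ^ m + 1⌉) ⌈R * 2 ^ m + 1⌉ := by
  obtain ⟨h1, h2⟩ := h
  have hp : (0 : ℝ) < 2 ^ m := by positivity
  rw [zpow_neg, zpow_natCast, ← div_eq_mul_inv] at h1 h2
  rw [div_le_iff₀ hp] at h1
  rw [le_div_iff₀ hp] at h2
  obtain ⟨h3, h4⟩ := abs_le.1 ht
  have hc := Int.le_ceil (R * 2 ^ m + 1)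
  have h5 := mul_le_mul_of_nonneg_right h3 hp.le
  have h6 := mul_le_mul_of_nonneg_right h4 hp.le
  constructor
  · have : ((-⌈R * 2 ^ m + 1⌉ : ℤ) : ℝ) ≤ k := by push_cast; linarith
    exact_mod_cast this
  · have : (k : ℝ) ≤ (⌈R * 2 ^ m + 1⌉ : ℤ) := by linarith
    exact_mod_cast this

lemma dy_finite (X : Set ℂ) (hX : Bornology.IsBounded X) (m : ℕ) :
    {q : ℤ × ℤ | (dyadicSq m q.1 q.2 ∩ X).Nonempty}.Finite := by
  obtain ⟨R, hR⟩ := hX.exists_norm_le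
  apply ((Set.finite_Icc (-⌈R * 2 ^ m + 1⌉) ⌈R * 2 ^ m + 1⌉).prod
    (Set.finite_Icc (-⌈R * 2 ^ m + 1⌉) ⌈R * 2 ^ m + 1⌉)).subset
  rintro ⟨k, l⟩ ⟨z, hz, hzX⟩
  exact ⟨dy_int_bound m R z.re k ((Complex.abs_re_le_norm z).trans (hR z hzX)) hz.1,
    dy_int_bound m R z.im l ((Complex.abs_im_le_norm z).trans (hR z hzX)) hz.2⟩

lemma sum_slices {α β : Type*} (P : Set (α × β)) (hP : P.Finite) (F : Finset α) :
    ∑ q ∈ F, {b | (q, b) ∈ P}.ncard ≤ P.ncard := by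
  classical
  have h1 : ∀ q, {b | (q, b) ∈ P}.ncard = (hP.toFinset.filter (fun p => p.1 = q)).card := by
    intro q
    rw [← Set.ncard_image_of_injective _ (Prod.mk_right_injective q), ← Set.ncard_coe_finset]
    congr 1
    ext ⟨a, b⟩
    simp only [Set.mem_image, Set.mem_setOf_eq, Finset.coe_filter, Set.Finite.mem_toFinset,
      Prod.mk.injEq]
    constructor
    · rintro ⟨c, hc, rfl, rfl⟩
      exact ⟨hc, rfl⟩
    · rintro ⟨h, rfl⟩
      exact ⟨b, h, rfl, rfl⟩
  simp_rw [h1]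
  rw [Set.ncard_eq_toFinset_card P hP, ← Finset.card_biUnion]
  · apply Finset.card_le_card
    intro p hp
    simp only [Finset.mem_biUnion, Finset.mem_filter] at hp
    obtain ⟨_, _, h, _⟩ := hp
    exact h
  · intro a _ b _ hab
    rw [Function.onFun, Finset.disjoint_left]
    intro p hp hp'
    exact hab ((Finset.mem_filter.1 hp).2.symm.trans (Finset.mem_filter.1 hp').2)

/-- Let `X ⊆ ℂ` be bounded and `x, T > 0` be such that
`∑_{S ∈ 𝒮^m} #𝒮^n(X ∩ S) ≤ T · 2^{nx}` for all integers `0 ≤ m ≤ n` (the sum being the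
number of pairs `(S, S') ∈ 𝒮^m × 𝒮^n` with `S' ∩ X ∩ S ≠ ∅`).  Then for every `ζ > 0`,
`A > 0` and `m ∈ ℕ`, the number of squares `S ∈ 𝒮^m(X)` for which there exists `n ≥ m` with
`#𝒮^n(X ∩ S) > A · T · 2^{(n−m)(x+ζ)}` is at most `(1 − 2^{−ζ})⁻¹ · A⁻¹ · 2^{m(x+ζ)}`. -/
theorem count_bad_squares (X : Set ℂ) (hX : Bornology.IsBounded X)
    (x T : ℝ) (hx : 0 < x) (hT : 0 < T)
    (hcount : ∀ m n : ℕ, m ≤ n →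
      (({p : (ℤ × ℤ) × (ℤ × ℤ) |
          (dyadicSq n p.2.1 p.2.2 ∩ (X ∩ dyadicSq m p.1.1 p.1.2)).Nonempty} :
            Set ((ℤ × ℤ) × (ℤ × ℤ))).ncard : ℝ) ≤ T * (2 : ℝ) ^ ((n : ℝ) * x)) :
    ∀ ζ : ℝ, 0 < ζ → ∀ A : ℝ, 0 < A → ∀ m : ℕ,
      (({q : ℤ × ℤ | (dyadicSq m q.1 q.2 ∩ X).Nonempty ∧
          ∃ n : ℕ, m ≤ n ∧
            A * T * (2 : ℝ) ^ (((n : ℝ) - (m : ℝ)) * (x + ζ)) <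
              (({q' : ℤ × ℤ |
                  (dyadicSq n q'.1 q'.2 ∩ (X ∩ dyadicSq m q.1 q.2)).Nonempty} :
                    Set (ℤ × ℤ)).ncard : ℝ)} : Set (ℤ × ℤ)).ncard : ℝ) ≤
        (1 - (2 : ℝ) ^ (-ζ))⁻¹ * A⁻¹ * (2 : ℝ) ^ ((m : ℝ) * (x + ζ)) := by
  classical
  intro ζ hζ A hA m
  set B := {q : ℤ × ℤ | (dyadicSq m q.1 q.2 ∩ X).Nonempty ∧
          ∃ n : ℕ, m ≤ n ∧
            A * T * (2 : ℝ) ^ (((n : ℝ) - (m : ℝ)) * (x + ζ)) <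
              (({q' : ℤ × ℤ |
                  (dyadicSq n q'.1 q'.2 ∩ (X ∩ dyadicSq m q.1 q.2)).Nonempty} :
                    Set (ℤ × ℤ)).ncard : ℝ)} with hB
  have hBfin : B.Finite := (dy_finite X hX m).subset (fun q hq => hq.1)
  have hex : ∀ q : ℤ × ℤ, ∃ j : ℕ, q ∈ B → A * T * (2 : ℝ) ^ ((j : ℝ) * (x + ζ)) <
              (({q' : ℤ × ℤ |
                  (dyadicSq (m + j) q'.1 q'.2 ∩ (X ∩ dyadicSq m q.1 q.2)).Nonempty} :
                    Set (ℤ × ℤ)).ncard : ℝ) := by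
    intro q
    by_cases hq : q ∈ B
    · obtain ⟨_, n, hn, h⟩ := hq
      obtain ⟨j, rfl⟩ := Nat.exists_eq_add_of_le hn
      refine ⟨j, fun _ => ?_⟩
      push_cast at h
      rwa [add_sub_cancel_left] at h
    · exact ⟨0, fun h => absurd h hq⟩
  choose N hN using hex
  have hr0 : (0 : ℝ) ≤ 2 ^ (-ζ) := by positivity
  have hr1 : (2 : ℝ) ^ (-ζ) < 1 := Real.rpow_lt_one_of_one_lt_of_neg (by norm_num) (by linarith)
  have key : ∀ j : ℕ, (((hBfin.toFinset.filter (fun q => N q = j)).card : ℕ) : ℝ) ≤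
      A⁻¹ * (2 : ℝ) ^ ((m : ℝ) * x) * ((2 : ℝ) ^ (-ζ)) ^ j := by
    intro j
    set F := hBfin.toFinset.filter (fun q => N q = j) with hF
    have hPfin : {p : (ℤ × ℤ) × (ℤ × ℤ) |
          (dyadicSq (m + j) p.2.1 p.2.2 ∩ (X ∩ dyadicSq m p.1.1 p.1.2)).Nonempty}.Finite := by
      apply ((dy_finite X hX m).prod (dy_finite X hX (m + j))).subset
      rintro p ⟨z, h1, h2, h3⟩
      exact ⟨⟨z, h3, h2⟩, ⟨z, h1, h2⟩⟩
    have h1 := sum_slices _ hPfin F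
    have h2 := hcount m (m + j) (Nat.le_add_right _ _)
    have h3 : (F.card : ℝ) * (A * T * (2 : ℝ) ^ ((j : ℝ) * (x + ζ))) ≤
        T * (2 : ℝ) ^ (((m + j : ℕ) : ℝ) * x) := by
      refine le_trans ?_ h2
      refine le_trans ?_ (Nat.cast_le.2 h1)
      rw [← nsmul_eq_mul, Nat.cast_sum]
      apply Finset.card_nsmul_le_sum
      intro q hq
      rw [hF, Finset.mem_filter, Set.Finite.mem_toFinset] at hq
      have := hN q hq.1
      rw [hq.2] at this
      exact this.le
    have hpos : 0 < A * T * (2 : ℝ) ^ ((j : ℝ) * (x + ζ)) := by positivity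
    rw [← le_div_iff₀ hpos] at h3
    refine h3.trans (le_of_eq ?_)
    rw [div_eq_iff hpos.ne', ← Real.rpow_natCast, ← Real.rpow_mul (by norm_num)]
    have : (2 : ℝ) ^ (((m + j : ℕ) : ℝ) * x) =
        2 ^ ((m : ℝ) * x) * 2 ^ (-ζ * (j : ℝ)) * 2 ^ ((j : ℝ) * (x + ζ)) := by
      rw [← Real.rpow_add (by norm_num), ← Real.rpow_add (by norm_num)]
      congr 1
      push_cast
      ring
    rw [this]
    field_simp
  have hsum : (B.ncard : ℝ) ≤ A⁻¹ * (2 : ℝ) ^ ((m : ℝ) * x) * (1 - (2 : ℝ) ^ (-ζ))⁻¹ := by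
    rw [Set.ncard_eq_toFinset_card B hBfin, Finset.card_eq_sum_card_image N, Nat.cast_sum]
    refine (Finset.sum_le_sum (fun j _ => key j)).trans ?_
    rw [← Finset.mul_sum, ← tsum_geometric_of_lt_one hr0 hr1]
    apply mul_le_mul_of_nonneg_left _ (by positivity)
    exact (summable_geometric_of_lt_one hr0 hr1).sum_le_tsum _ (fun _ _ => by positivity)
  refine hsum.trans ?_
  have h4 : (2 : ℝ) ^ ((m : ℝ) * x) ≤ 2 ^ ((m : ℝ) * (x + ζ)) := by
    apply Real.rpow_le_rpow_of_exponent_le (by norm_num)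
    apply mul_le_mul_of_nonneg_left (by linarith) (by positivity)
  have h5 : 0 ≤ (1 - (2 : ℝ) ^ (-ζ))⁻¹ * A⁻¹ :=
    mul_nonneg (inv_nonneg.2 (by linarith)) (by positivity)
  calc _ = (1 - (2 : ℝ) ^ (-ζ))⁻¹ * A⁻¹ * (2 : ℝ) ^ ((m : ℝ) * x) := by ring
    _ ≤ _ := mul_le_mul_of_nonneg_left h4 h5
end
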